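/- arXiv:1808.10589 — 2 statements merged into one kernel-verified Lean document; each statement's English description precedes it below -/
import Mathlib

section
/- For all integers r, s ≥ 1, Σ_{σ} ∏_{U ∈ Π(σ)} (−1)^{|U|−1} C_{|U|−1} = (−1)^{r+s−1} · (2/(r+s)) · ((2r−1)!/((r−1)!)²) · ((2s−1)!/((s−1)!)²), where the sum is over all σ ∈ S_ann-nc(r,s) all of whose cycles are bridges, and the product is over the orbits U of σ. -/
namespace AnnNC

/-- The orbit ("same cycle") setoid of a permutation. -/
def orbitSetoid {α : Type*} (σ : Equiv.Perm α) : Setoid α :=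
  ⟨σ.SameCycle, ⟨fun x => Equiv.Perm.SameCycle.refl σ x,
    fun h => h.symm, fun h h' => h.trans h'⟩⟩

/-- Number of orbits (cycles, counting fixed points) of a permutation. -/
noncomputable def numOrbits {α : Type*} (σ : Equiv.Perm α) : ℕ :=
  Nat.card (Quotient (orbitSetoid σ))

/-- Number of blocks of the join `Π(σ) ∨ Π(ρ)` of the orbit partitions. -/
noncomputable def numJoin {α : Type*} (σ ρ : Equiv.Perm α) : ℕ :=
  Nat.card (Quotient (orbitSetoid σ ⊔ orbitSetoid ρ))

/-- Euler characteristic `χ_ρ(π) = #(ρ) + #(π) + #(π⁻¹ρ) − n`. -/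
noncomputable def euler {α : Type*} (ρ π : Equiv.Perm α) : ℤ :=
  (numOrbits ρ : ℤ) + (numOrbits π : ℤ) + (numOrbits (π⁻¹ * ρ) : ℤ) - (Nat.card α : ℤ)

/-- `π` is noncrossing on `ρ`. -/
def IsNoncrossingOn {α : Type*} (π ρ : Equiv.Perm α) : Prop :=
  euler ρ π = 2 * (numJoin π ρ : ℤ)

/-- Euler characteristic of permutations regarded as permutations of a subset `S`
(for permutations fixing the complement of `S` pointwise). -/
noncomputable def eulerOn {α : Type*} (S : Set α) (ρ π : Equiv.Perm α) : ℤ :=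
  ((numOrbits ρ : ℤ) - (Nat.card (Sᶜ : Set α) : ℤ)) +
    ((numOrbits π : ℤ) - (Nat.card (Sᶜ : Set α) : ℤ)) +
    ((numOrbits (π⁻¹ * ρ) : ℤ) - (Nat.card (Sᶜ : Set α) : ℤ)) - (Nat.card (S : Set α) : ℤ)

/-- `π` is noncrossing on `ρ`, both regarded as permutations of the subset `S`. -/
def IsNoncrossingWithin {α : Type*} (S : Set α) (π ρ : Equiv.Perm α) : Prop :=
  eulerOn S ρ π = 2 * ((numJoin π ρ : ℤ) - (Nat.card (Sᶜ : Set α) : ℤ))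

/-- `τ_{p,q} = (1,…,p)(p+1,…,p+q)` as a permutation of `Fin (p+q)`. -/
def tauPQ (p q : ℕ) : Equiv.Perm (Fin (p + q)) :=
  Equiv.permCongr finSumFinEquiv (Equiv.sumCongr (finRotate p) (finRotate q))

/-- Disc-noncrossing permutations: noncrossing on `τ_{p,q}` and the orbit partition
refines that of `τ_{p,q}`. -/
def SDiscNC (p q : ℕ) : Set (Equiv.Perm (Fin (p + q))) :=
  {π | IsNoncrossingOn π (tauPQ p q) ∧
    ∀ x y : Fin (p + q), π.SameCycle x y → ((x : ℕ) < p ↔ (y : ℕ) < p)}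

/-- Annular-noncrossing permutations: noncrossing on `τ_{p,q}` with at least one bridge. -/
def SAnnNC (p q : ℕ) : Set (Equiv.Perm (Fin (p + q))) :=
  {π | IsNoncrossingOn π (tauPQ p q) ∧
    ∃ a b : Fin (p + q), π.SameCycle a b ∧ (a : ℕ) < p ∧ p ≤ (b : ℕ)}

/-- The set of elements lying in bridges of `σ`. -/
def BridgeSet (p q : ℕ) (σ : Equiv.Perm (Fin (p + q))) : Set (Fin (p + q)) :=
  {x | ∃ a b : Fin (p + q), σ.SameCycle x a ∧ σ.SameCycle x b ∧ (a : ℕ) < p ∧ p ≤ (b : ℕ)}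

/-- `π₀` is the permutation induced by `π` on the partition `Π(τ_{p,q})`
(the first–return map of `π` to each of the two sides). -/
def IsPiZero (p q : ℕ) (π π₀ : Equiv.Perm (Fin (p + q))) : Prop :=
  ∀ a : Fin (p + q), ∃ k : ℕ, 0 < k ∧ π₀ a = (π ^ k) a ∧
    (((a : ℕ) < p) ↔ (((π ^ k) a : ℕ) < p)) ∧
    ∀ j : ℕ, 0 < j → j < k → ¬ (((a : ℕ) < p) ↔ (((π ^ j) a : ℕ) < p))

/-- The order `π ⪯ ρ` for (unhatted) permutations: the orbit partition of `π` refines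
that of `ρ` and `π` is noncrossing on `ρ`. -/
def permLe {α : Type*} (π ρ : Equiv.Perm α) : Prop :=
  (∀ x y : α, π.SameCycle x y → ρ.SameCycle x y) ∧ IsNoncrossingOn π ρ

/-- The order relation `π ⪯ ρ̂` in `S_nc-sd(p,q)`, i.e. `Kr(ρ) ⪯ Kr(π)`. -/
def leAnnHat (p q : ℕ) (π ρ : Equiv.Perm (Fin (p + q))) : Prop :=
  permLe (ρ⁻¹ * tauPQ p q) (π⁻¹ * tauPQ p q)

/-- `σ` is the permutation induced by `π` on the subset `J` (first-return map),
extended by the identity off `J`. -/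
def IsInducedOn {α : Type*} (π σ : Equiv.Perm α) (J : Set α) : Prop :=
  (∀ a ∉ J, σ a = a) ∧
  ∀ a ∈ J, ∃ k : ℕ, 0 < k ∧ σ a = (π ^ k) a ∧ (π ^ k) a ∈ J ∧
    ∀ j : ℕ, 0 < j → j < k → (π ^ j) a ∉ J

/-- The size of an orbit of a permutation. -/
noncomputable def orbitSize {α : Type*} (σ : Equiv.Perm α) (c : Quotient (orbitSetoid σ)) : ℕ :=
  Nat.card {x : α // Quotient.mk (orbitSetoid σ) x = c}

/-- `∏_{U ∈ Π(σ)} (−1)^{|U|−1} C_{|U|−1}`. -/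
noncomputable def catProd {α : Type*} (σ : Equiv.Perm α) : ℤ :=
  ∏ᶠ c : Quotient (orbitSetoid σ),
    ((-1 : ℤ) ^ (orbitSize σ c - 1) * (catalan (orbitSize σ c - 1) : ℤ))

/-- The carrier of the poset `S_nc-sd(p,q)`: pairs (permutation, hatted?). -/
def NCSDSet (p q : ℕ) : Set (Equiv.Perm (Fin (p + q)) × Bool) :=
  {z | (z.2 = false ∧ (z.1 ∈ SDiscNC p q ∪ SAnnNC p q)) ∨ (z.2 = true ∧ z.1 ∈ SDiscNC p q)}

/-- The partial order of `S_nc-sd(p,q)`. -/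
def ncsdLe (p q : ℕ) (a b : Equiv.Perm (Fin (p + q)) × Bool) : Prop :=
  (a.2 = false ∧ b.2 = false ∧ permLe a.1 b.1) ∨
  (b.2 = true ∧ permLe (b.1⁻¹ * tauPQ p q) (a.1⁻¹ * tauPQ p q))

end AnnNC

namespace AnnNC

open PowerSeries in
/-- The series in two variables whose coefficients depend only on the total degree, restricted to
positive exponents. -/
noncomputable def bisum (f : ℕ → ℚ) : ℚ⟦X⟧⟦X⟧ :=
  PowerSeries.mk fun s => PowerSeries.mk fun r => if r = 0 ∨ s = 0 then 0 else f (r + s)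

/-- The signed Catalan weight of a cycle of length `n`. -/
noncomputable def signedCat (n : ℕ) : ℚ := (-1) ^ (n - 1) * (catalan (n - 1) : ℚ)

open PowerSeries in
/-- The one-variable series with coefficients `f n` for `n ≥ 1`. -/
noncomputable def posSeries (f : ℕ → ℚ) : ℚ⟦X⟧ := PowerSeries.mk fun n => if n = 0 then 0 else f n

open PowerSeries in
theorem bisum_mul (f : ℕ → ℚ) :
    (C (X : ℚ⟦X⟧) - X) * bisum f =
      X * C (posSeries f) - C X * PowerSeries.map (C : ℚ →+* ℚ⟦X⟧) (posSeries f) := by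
  ext s r
  rw [sub_mul]
  obtain _ | s := s <;> obtain _ | r := r
  all_goals simp [bisum, posSeries, coeff_succ_X_mul, coeff_C_mul, coeff_zero_X_mul]
  · rw [← coeff_zero_eq_constantCoeff_apply, coeff_map]
    simp
  · rcases s with _ | s <;> rcases r with _ | r <;> simp [coeff_X]
    · rw [add_comm]
    · rw [sub_eq_zero]
      congr 1
      ring

open PowerSeries in
theorem posSeries_signedCat_sq :
    posSeries signedCat + posSeries signedCat ^ 2 = X := by
  set v : ℚ⟦X⟧ := PowerSeries.mk fun n => (-1) ^ n * (catalan n : ℚ) with hv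
  have h1 : posSeries signedCat = X * v := by
    ext n
    rcases n with _ | n <;> simp [posSeries, signedCat, hv, coeff_succ_X_mul]
  have h2 : v = 1 - X * v ^ 2 := by
    ext n
    rcases n with _ | n
    · simp [hv]
    · rw [map_sub, coeff_succ_X_mul, sq, coeff_mul, hv]
      simp only [coeff_mk, coeff_one, catalan_succ', Nat.cast_sum, Nat.cast_mul, Finset.mul_sum]
      rw [if_neg (by omega), zero_sub, ← Finset.sum_neg_distrib]
      refine Finset.sum_congr rfl fun p hp => ?_
      rw [← Finset.HasAntidiagonal.mem_antidiagonal.1 hp]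
      ring
  rw [h1]
  linear_combination X * h2

open PowerSeries in
theorem derivative_posSeries_signedCat (n : ℕ) :
    coeff n (d⁄dX ℚ (posSeries signedCat)) = (-1) ^ n * (n.centralBinom : ℚ) := by
  rw [coeff_derivative, ← succ_mul_catalan_eq_centralBinom]
  simp [posSeries, signedCat]
  ring

open PowerSeries in
theorem derivative_posSeries_signedCat_mul :
    d⁄dX ℚ (posSeries signedCat) * (1 + 2 * posSeries signedCat) = 1 := by
  have h := congrArg (d⁄dX ℚ) posSeries_signedCat_sq
  rw [map_add, derivative_pow, derivative_X] at h
  linear_combination h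

open PowerSeries in
theorem coeff_coeff_mul (f g : ℚ⟦X⟧) (r s : ℕ) :
    coeff r (coeff s (C f * PowerSeries.map (C : ℚ →+* ℚ⟦X⟧) g)) = coeff r f * coeff s g := by
  simp [coeff_C_mul]

open PowerSeries in
theorem coeff_coeff_bisum_mul (f : ℕ → ℚ) (T : ℚ⟦X⟧⟦X⟧) (r s : ℕ) :
    coeff r (coeff s (bisum f * T)) = ∑ x ∈ Finset.range r, ∑ y ∈ Finset.range s,
      f (r - x + (s - y)) * coeff x (coeff y T) := by
  rw [coeff_mul, map_sum, Finset.sum_comm,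
    Finset.Nat.sum_antidiagonal_eq_sum_range_succ_mk, ← Finset.sum_range_reflect]
  rw [Finset.sum_range_succ]
  have : ∀ y ∈ Finset.range s, coeff r (coeff (s + 1 - 1 - y) (bisum f) *
      coeff (s - (s + 1 - 1 - y)) T) = ∑ x ∈ Finset.range r,
        f (r - x + (s - y)) * coeff x (coeff y T) := by
    intro y hy
    rw [Finset.mem_range] at hy
    rw [coeff_mul, Finset.Nat.sum_antidiagonal_eq_sum_range_succ_mk, ← Finset.sum_range_reflect,
      Finset.sum_range_succ]
    simp only [bisum, coeff_mk]
    rw [if_pos (by omega), zero_mul, add_zero]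
    refine Finset.sum_congr rfl fun x hx => ?_
    rw [Finset.mem_range] at hx
    rw [if_neg (by omega)]
    rw [show r - (r + 1 - 1 - x) = x by omega, show s - (s + 1 - 1 - y) = y by omega,
      show r + 1 - 1 - x + (s + 1 - 1 - y) = r - x + (s - y) by omega]
  rw [Finset.sum_congr rfl this]
  simp [bisum]
  rw [coeff_mul]
  simp

open PowerSeries in
theorem exists_chain_weight : ∃ T : ℕ → ℕ → ℚ,
    T 0 0 = 1 ∧
    (∀ r s, ¬(r = 0 ∧ s = 0) → T r s = ∑ x ∈ Finset.range r, ∑ y ∈ Finset.range s,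
      signedCat (r - x + (s - y)) * T x y) ∧
    ∀ r s, 1 ≤ r → 1 ≤ s → ∑ x ∈ Finset.range r, ∑ y ∈ Finset.range s,
      ((r - x + (s - y) : ℕ) : ℚ) * signedCat (r - x + (s - y)) * T x y =
        (-1) ^ (r + s - 1) * (r.centralBinom * s.centralBinom / 2) := by
  set u := posSeries signedCat with hu
  set D := d⁄dX ℚ u with hD
  have hu0 : constantCoeff u = 0 := by simp [hu, posSeries]
  have hinv : (1 + u) * (1 + u)⁻¹ = 1 := PowerSeries.mul_inv_cancel _ (by simp [hu0])
  have hx := posSeries_signedCat_sq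
  have hd := derivative_posSeries_signedCat_mul
  rw [← hu] at hx hd
  rw [← hD] at hd
  set J := PowerSeries.map (C : ℚ →+* ℚ⟦X⟧) with hJ
  have hJX : J X = X := by simp [hJ]
  set U := (C u : ℚ⟦X⟧⟦X⟧)
  set V := J u
  have hX : U + U ^ 2 = C X := by rw [← hx]; simp [U]
  have hY : V + V ^ 2 = X := by
    rw [← hJX, ← hx]; simp only [map_add, map_pow, V]
  set P : ℚ⟦X⟧⟦X⟧ := C (1 + u)⁻¹
  set Q := J (1 + u)⁻¹
  have hP : (1 + U) * P = 1 := by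
    have := congrArg (C : ℚ⟦X⟧ →+* ℚ⟦X⟧⟦X⟧) hinv
    rwa [map_mul, map_add, map_one] at this
  have hQ : (1 + V) * Q = 1 := by
    have := congrArg J hinv
    rwa [map_mul, map_add, map_one] at this
  have hne : U - V ≠ 0 := by
    intro h
    have := congrArg (fun z => coeff 1 (coeff 0 z)) h
    simp only [map_sub, map_zero, U, V, hJ, coeff_map, coeff_zero_C] at this
    simp [hu, posSeries, signedCat] at this
  have hF : bisum signedCat * (1 + U + V) = - (U * V) := by
    apply mul_left_cancel₀ hne
    have := bisum_mul signedCat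
    rw [← hu, ← hX, ← hY] at this
    change _ = (V + V ^ 2) * U - (U + U ^ 2) * V at this
    linear_combination this
  have hT : (1 - bisum signedCat) * ((1 + U + V) * P * Q) = 1 := by
    linear_combination (-(P * Q)) * hF + (1 + V) * Q * hP + hQ
  set DU : ℚ⟦X⟧⟦X⟧ := C D
  set DV := J D
  have hDU : DU * (1 + 2 * U) = 1 := by
    have := congrArg (C : ℚ⟦X⟧ →+* ℚ⟦X⟧⟦X⟧) hd
    simpa only [map_mul, map_add, map_one, map_ofNat] using this
  have hDV : DV * (1 + 2 * V) = 1 := by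
    have := congrArg J hd
    simpa only [map_mul, map_add, map_one, map_ofNat] using this
  have hpos : posSeries (fun n => n * signedCat n) = X * D := by
    ext n
    rcases n with _ | n
    · simp [posSeries]
    · rw [coeff_succ_X_mul, hD, coeff_derivative, hu]
      simp [posSeries, mul_comm]
  set E := bisum (fun n => n * signedCat n) with hE
  have hE1 : E * (1 + U + V) = - 2 * (U * (1 + U) * (V * (1 + V))) * (DU * DV) := by
    apply mul_left_cancel₀ hne
    have := bisum_mul (fun n => n * signedCat n)
    rw [hpos, map_mul, map_mul, ← hJ, hJX, ← hX, ← hY, ← hE] at this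
    change _ = (V + V ^ 2) * ((U + U ^ 2) * DU) - (U + U ^ 2) * ((V + V ^ 2) * DV) at this
    linear_combination this - (V + V ^ 2) * (U + U ^ 2) * DU * hDV +
       (V + V ^ 2) * (U + U ^ 2) * DV * hDU
  have hET : E * ((1 + U + V) * P * Q) = C (-2 * (u * D)) * J (u * D) := by
    have : C (-2 * (u * D)) * J (u * D) = -2 * (U * DU) * (V * DV) := by
      simp only [map_mul, map_neg, map_ofNat, U, V, DU, DV]
    rw [this]
    linear_combination P * Q * hE1 - 2 * U * V * DU * DV * (1 + V) * Q * hP -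
       2 * U * V * DU * DV * hQ
  have huD : ∀ n, 1 ≤ n → coeff n (u * D) = - ((-1) ^ n * n.centralBinom / 2) := by
    intro n hn
    have h2 : C (2 : ℚ) * (u * D) = 1 - D := by
      rw [map_ofNat]
      linear_combination hd
    have := congrArg (coeff n) h2
    rw [coeff_C_mul, map_sub, coeff_one, if_neg (by omega), hD, hu,
      derivative_posSeries_signedCat] at this
    rw [hD, hu]
    linear_combination this / 2
  set T := (1 + U + V) * P * Q
  have hT' : T = 1 + bisum signedCat * T := by linear_combination hT
  refine ⟨fun r s => coeff r (coeff s T), ?_, ?_, ?_⟩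
  · dsimp only
    rw [hT', map_add, map_add, coeff_coeff_bisum_mul]
    simp
  · intro r s h
    dsimp only
    conv_lhs => rw [hT']
    rw [map_add, map_add, coeff_coeff_bisum_mul, coeff_one]
    split_ifs with hs
    · rw [coeff_one, if_neg (by tauto), zero_add]
    · simp
  · intro r s hr hs
    have := congrArg (fun z => coeff r (coeff s z)) hET
    simp only [hJ, coeff_coeff_mul] at this
    rw [hE, coeff_coeff_bisum_mul, show (-2 : ℚ⟦X⟧) = C (-2) by rw [map_neg, map_ofNat], coeff_C_mul,
      huD r hr,
      huD s hs] at this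
    rw [this]
    obtain ⟨k, hk⟩ : ∃ k, r + s = k + 1 := ⟨r + s - 1, by omega⟩
    have hk2 : (-1 : ℚ) ^ r * (-1) ^ s = - (-1) ^ k := by rw [← pow_add, hk, pow_succ]; ring
    rw [hk, Nat.add_sub_cancel]
    linear_combination (-(r.centralBinom : ℚ) * s.centralBinom / 2) * hk2

section Chains

variable {α : Type*}

theorem sameCycle_mul_iff_of_disjoint {c σ : Equiv.Perm α} (h : c.Disjoint σ) {z z' : α}
    (hz : c z = z) : (c * σ).SameCycle z z' ↔ σ.SameCycle z z' := by
  refine exists_congr fun n => ?_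
  rw [h.commute.eq, h.commute.symm.mul_zpow, Equiv.Perm.mul_apply,
    Equiv.Perm.zpow_apply_eq_self_of_apply_eq_self hz]

/-- `o` and `p` enumerate disjoint families of `r` and `s` points. -/
structure Enumerates (o p : ℕ → α) (r s : ℕ) : Prop where
  o_inj : ∀ i < r, ∀ j < r, o i = o j → i = j
  p_inj : ∀ i < s, ∀ j < s, p i = p j → i = j
  ne : ∀ i j, o i ≠ p j

variable [DecidableEq α]

/-- The cycle `o x → ⋯ → o (r - 1) → p (s - 1) → ⋯ → p y → o x`. -/
def bridgeCycle (o p : ℕ → α) (x r y s : ℕ) : Equiv.Perm α :=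
  List.formPerm ((List.range (r - x)).map (fun i => o (x + i)) ++
    (List.range (s - y)).map (fun j => p (s - 1 - j)))

section bridgeCycle

variable {o p : ℕ → α} {x r y s : ℕ}

omit [DecidableEq α] in
theorem nodup_bridgeCycle (h : Enumerates o p r s) :
    ((List.range (r - x)).map (fun i => o (x + i)) ++
      (List.range (s - y)).map (fun j => p (s - 1 - j))).Nodup := by
  rw [List.nodup_append]
  refine ⟨?_, ?_, ?_⟩
  · refine List.Nodup.map_on ?_ List.nodup_range
    intro i hi j hj hij
    rw [List.mem_range] at hi hj
    have := h.o_inj _ (by omega) _ (by omega) hij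
    omega
  · refine List.Nodup.map_on ?_ List.nodup_range
    intro i hi j hj hij
    rw [List.mem_range] at hi hj
    have := h.p_inj _ (by omega) _ (by omega) hij
    omega
  · simp only [List.mem_map]
    rintro _ ⟨i, -, rfl⟩ _ ⟨j, -, rfl⟩
    exact h.ne _ _

theorem bridgeCycle_o (h : Enumerates o p r s) {i : ℕ} (hi : x ≤ i) (hir : i + 1 < r) :
    bridgeCycle o p x r y s (o i) = o (i + 1) := by
  have := List.formPerm_apply_lt_getElem _ (nodup_bridgeCycle (x := x) (y := y) h) (i - x)
    (by simp; omega)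
  rw [List.getElem_append_left (by simp; omega), List.getElem_append_left (by simp; omega)] at this
  simp only [List.getElem_map, List.getElem_range] at this
  rwa [show x + (i - x) = i by omega, show x + (i - x + 1) = i + 1 by omega] at this

theorem bridgeCycle_o_last (h : Enumerates o p r s) (hx : x < r) (hy : y < s) :
    bridgeCycle o p x r y s (o (r - 1)) = p (s - 1) := by
  have := List.formPerm_apply_lt_getElem _ (nodup_bridgeCycle (x := x) (y := y) h) (r - 1 - x)
    (by simp; omega)
  rw [List.getElem_append_left (by simp; omega), List.getElem_append_right (by simp; omega)] at this
  simp only [List.getElem_map, List.getElem_range, List.length_map, List.length_range] at this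
  rwa [show x + (r - 1 - x) = r - 1 by omega,
    show s - 1 - (r - 1 - x + 1 - (r - x)) = s - 1 by omega] at this

theorem bridgeCycle_p (h : Enumerates o p r s) {j : ℕ} (hj : y ≤ j) (hjs : j + 1 < s) :
    bridgeCycle o p x r y s (p (j + 1)) = p j := by
  have := List.formPerm_apply_lt_getElem _ (nodup_bridgeCycle (x := x) (y := y) h)
    (r - x + (s - 1 - (j + 1))) (by simp; omega)
  rw [List.getElem_append_right (by simp), List.getElem_append_right (by simp; omega)] at this
  simp only [List.getElem_map, List.getElem_range, List.length_map, List.length_range] at this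
  rwa [show s - 1 - (r - x + (s - 1 - (j + 1)) - (r - x)) = j + 1 by omega,
    show s - 1 - (r - x + (s - 1 - (j + 1)) + 1 - (r - x)) = j by omega] at this

theorem bridgeCycle_p_last (h : Enumerates o p r s) (hx : x < r) (hy : y < s) :
    bridgeCycle o p x r y s (p y) = o x := by
  have := List.formPerm_apply_getElem _ (nodup_bridgeCycle (x := x) (y := y) h)
    (r - x + (s - y) - 1) (by simp; omega)
  have h0 : (r - x + (s - y) - 1 + 1) % (r - x + (s - y)) = 0 := by
    rw [Nat.sub_add_cancel (by omega), Nat.mod_self]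
  simp only [List.length_append, List.length_map, List.length_range, h0] at this
  rw [List.getElem_append_right (by simp; omega), List.getElem_append_left (by simp; omega)] at this
  simp only [List.getElem_map, List.getElem_range, List.length_map, List.length_range] at this
  rwa [show s - 1 - (r - x + (s - y) - 1 - (r - x)) = y by omega, add_zero] at this

theorem bridgeCycle_of_notMem {z : α} (ho : ∀ i, x ≤ i → i < r → o i ≠ z)
    (hp : ∀ j, y ≤ j → j < s → p j ≠ z) : bridgeCycle o p x r y s z = z := by
  refine List.formPerm_apply_of_notMem ?_
  simp only [List.mem_append, List.mem_map, List.mem_range, not_or, not_exists, not_and]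
  exact ⟨fun i hi => ho _ (by omega) (by omega), fun j hj => hp _ (by omega) (by omega)⟩

theorem isCycle_bridgeCycle (h : Enumerates o p r s) (hx : x < r) (hy : y < s) :
    (bridgeCycle o p x r y s).IsCycle :=
  List.isCycle_formPerm (nodup_bridgeCycle h) (by simp; omega)

theorem card_support_bridgeCycle [Fintype α] (h : Enumerates o p r s) (hx : x < r) (hy : y < s) :
    (bridgeCycle o p x r y s).support.card = r - x + (s - y) := by
  rw [bridgeCycle, List.support_formPerm_of_nodup _ (nodup_bridgeCycle h),
    List.toFinset_card_of_nodup (nodup_bridgeCycle h)]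
  · simp
  · intro z hz
    have := congrArg List.length hz
    simp at this
    omega

end bridgeCycle

/-- `σ` is a product of bridge cycles forming a chain from `(0, 0)` to `(r, s)`, described locally:
`σ` follows the two enumerations (`o` upwards, `p` downwards) except at matched crossings. -/
structure IsChain (o p : ℕ → α) (r s : ℕ) (σ : Equiv.Perm α) : Prop where
  fix : ∀ z, (∀ i < r, o i ≠ z) → (∀ j < s, p j ≠ z) → σ z = z
  zero : r = 0 ↔ s = 0
  last : 0 < r → σ (o (r - 1)) = p (s - 1)
  first : 0 < r → σ (p 0) = o 0
  stepo : ∀ i, i + 1 < r → σ (o i) = o (i + 1) ∨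
    ∃ j, j + 1 < s ∧ σ (o i) = p j ∧ σ (p (j + 1)) = o (i + 1)
  stepp : ∀ j, j + 1 < s → σ (p (j + 1)) = p j ∨
    ∃ i, i + 1 < r ∧ σ (o i) = p j ∧ σ (p (j + 1)) = o (i + 1)
  uniq : ∀ i < r, ∀ i' < r, ∀ j j', σ (o i) = p j → σ (o i') = p j' →
    σ.SameCycle (o i) (o i') → i = i'

variable {o p : ℕ → α} {x r y s : ℕ} {σ : Equiv.Perm α}

omit [DecidableEq α] in
theorem Enumerates.mono (h : Enumerates o p r s) (hx : x ≤ r) (hy : y ≤ s) : Enumerates o p x y :=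
  ⟨fun i hi j hj => h.o_inj i (by omega) j (by omega),
    fun i hi j hj => h.p_inj i (by omega) j (by omega), h.ne⟩

omit [DecidableEq α] in
theorem IsChain.fix_o (hσ : IsChain o p x y σ) (h : Enumerates o p r s)
    {i : ℕ} (hi : x ≤ i) (hir : i < r) : σ (o i) = o i :=
  hσ.fix _ (fun k hk hki => by have := h.o_inj k (by omega) i hir hki; omega)
    fun j _ hj => h.ne _ _ hj.symm

omit [DecidableEq α] in
theorem IsChain.fix_p (hσ : IsChain o p x y σ) (h : Enumerates o p r s)
    {j : ℕ} (hj : y ≤ j) (hjs : j < s) : σ (p j) = p j :=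
  hσ.fix _ (fun _ _ hi => h.ne _ _ hi)
    fun k hk hkj => by have := h.p_inj k (by omega) j hjs hkj; omega

theorem bridgeCycle_fix_o (h : Enumerates o p r s) {i : ℕ} (hi : i < x) (hx : x < r) :
    bridgeCycle o p x r y s (o i) = o i :=
  bridgeCycle_of_notMem (fun k hk hkr hki => by have := h.o_inj k hkr i (by omega) hki; omega)
    fun j _ _ hj => h.ne _ _ hj.symm

theorem bridgeCycle_fix_p (h : Enumerates o p r s) {j : ℕ} (hj : j < y) (hy : y < s) :
    bridgeCycle o p x r y s (p j) = p j :=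
  bridgeCycle_of_notMem (fun _ _ _ hi => h.ne _ _ hi)
    fun k hk hks hkj => by have := h.p_inj k hks j (by omega) hkj; omega

theorem bridgeCycle_o_ne (h : Enumerates o p r s) (hy : y < s) {i : ℕ} (hi : x ≤ i) (hir : i < r) :
    bridgeCycle o p x r y s (o i) ≠ o i := by
  intro hci
  by_cases hir' : i + 1 < r
  · rw [bridgeCycle_o h hi hir'] at hci
    have := h.o_inj _ hir' _ hir hci
    omega
  · obtain rfl : i = r - 1 := by omega
    rw [bridgeCycle_o_last h (by omega) hy] at hci
    exact h.ne _ _ hci.symm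

theorem bridgeCycle_p_ne (h : Enumerates o p r s) (hx : x < r) {j : ℕ} (hj : y ≤ j) (hjs : j < s) :
    bridgeCycle o p x r y s (p j) ≠ p j := by
  intro hcj
  obtain rfl | hj' := eq_or_lt_of_le hj
  · rw [bridgeCycle_p_last h hx hjs] at hcj
    exact h.ne _ _ hcj
  · obtain ⟨j, rfl⟩ : ∃ k, j = k + 1 := ⟨j - 1, by omega⟩
    rw [bridgeCycle_p h (by omega) hjs] at hcj
    have := h.p_inj _ (by omega) _ hjs hcj
    omega

theorem IsChain.disjoint (hσ : IsChain o p x y σ) (h : Enumerates o p r s) :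
    (bridgeCycle o p x r y s).Disjoint σ := by
  intro z
  by_cases ho : ∃ i, x ≤ i ∧ i < r ∧ o i = z
  · obtain ⟨i, hi, hir, rfl⟩ := ho
    exact Or.inr (hσ.fix_o h hi hir)
  by_cases hp : ∃ j, y ≤ j ∧ j < s ∧ p j = z
  · obtain ⟨j, hj, hjs, rfl⟩ := hp
    exact Or.inr (hσ.fix_p h hj hjs)
  push Not at ho hp
  exact Or.inl (bridgeCycle_of_notMem ho hp)

theorem IsChain.glue (hσ : IsChain o p x y σ) (h : Enumerates o p r s) (hx : x < r)
    (hy : y < s) : IsChain o p r s (bridgeCycle o p x r y s * σ) := by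
  set c := bridgeCycle o p x r y s with hc
  have hd : c.Disjoint σ := hσ.disjoint h
  have hco : ∀ i < x, c (o i) = o i := fun i hi => bridgeCycle_fix_o h hi hx
  have hcp : ∀ j < y, c (p j) = p j := fun j hj => bridgeCycle_fix_p h hj hy
  have h1 : ∀ i < x, (c * σ) (o i) = σ (o i) := by
    intro i hi
    rw [Equiv.Perm.mul_apply]
    by_cases hix : i + 1 < x
    · obtain h' | ⟨j, hj, h', -⟩ := hσ.stepo i hix
      · rw [h', hco _ hix]
      · rw [h', hcp _ (by omega)]
    · have := hσ.zero
      obtain rfl : i = x - 1 := by omega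
      rw [hσ.last (by omega), hcp _ (by omega)]
  have h2 : ∀ j < y, (c * σ) (p j) = σ (p j) := by
    intro j hj
    have := hσ.zero
    rw [Equiv.Perm.mul_apply]
    rcases j with _ | j
    · rw [hσ.first (by omega), hco _ (by omega)]
    · obtain h' | ⟨i, hi, -, h'⟩ := hσ.stepp j hj
      · rw [h', hcp _ (by omega)]
      · rw [h', hco _ hi]
  have h3 : ∀ i, x ≤ i → i < r → (c * σ) (o i) = c (o i) := fun i hi hir => by
    rw [Equiv.Perm.mul_apply, hσ.fix_o h hi hir]
  have h4 : ∀ j, y ≤ j → j < s → (c * σ) (p j) = c (p j) := fun j hj hjs => by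
    rw [Equiv.Perm.mul_apply, hσ.fix_p h hj hjs]
  have hcross : 0 < x → (c * σ) (o (x - 1)) = p (y - 1) ∧ (c * σ) (p y) = o x := fun h0 =>
    ⟨by rw [h1 _ (by omega), hσ.last h0],
      by rw [h4 _ le_rfl hy, hc, bridgeCycle_p_last h hx hy]⟩
  have hz := hσ.zero
  have hlast : ∀ i, x ≤ i → i < r → ∀ j, (c * σ) (o i) = p j → i = r - 1 := by
    intro i hi hir j hij
    by_contra hne
    rw [h3 i hi hir, hc, bridgeCycle_o h hi (by omega)] at hij
    exact h.ne _ _ hij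
  have hdom : ∀ i, x ≤ i → i < r → ∀ i' < r, (c * σ).SameCycle (o i) (o i') → x ≤ i' := by
    intro i hi hir i' hir' hs
    by_contra hlt
    rw [Equiv.Perm.sameCycle_comm, sameCycle_mul_iff_of_disjoint hd (hco i' (by omega)),
      Equiv.Perm.sameCycle_comm] at hs
    have := h.o_inj _ hir _ hir'
      (hs.eq_of_left (hσ.fix_o h hi hir))
    omega
  refine ⟨?_, by omega, ?_, ?_, ?_, ?_, ?_⟩
  · intro z ho hp
    rw [Equiv.Perm.mul_apply, hσ.fix z (fun i hi => ho i (by omega)) fun j hj => hp j (by omega)]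
    exact bridgeCycle_of_notMem (fun i _ => ho i) fun j _ => hp j
  · intro _
    rw [h3 _ (by omega) (by omega), hc, bridgeCycle_o_last h hx hy]
  · intro _
    by_cases hy0 : y = 0
    · obtain rfl : x = 0 := by omega
      subst hy0
      rw [h4 _ le_rfl hy, hc, bridgeCycle_p_last h hx hy]
    · rw [h2 _ (by omega), hσ.first (by omega)]
  · intro i hi
    rcases lt_trichotomy (i + 1) x with hix | rfl | hix
    · rw [h1 i (by omega)]
      refine (hσ.stepo i hix).imp_right ?_
      rintro ⟨j, hj, hj1, hj2⟩
      exact ⟨j, by omega, hj1, by rw [h2 _ hj, hj2]⟩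
    · obtain ⟨ha, hb⟩ := hcross (by omega)
      exact Or.inr ⟨y - 1, by omega, ha, by rw [show y - 1 + 1 = y by omega, hb]⟩
    · exact Or.inl (by rw [h3 i (by omega) (by omega), hc, bridgeCycle_o h (by omega) hi])
  · intro j hj
    rcases lt_trichotomy (j + 1) y with hjy | rfl | hjy
    · rw [h2 _ hjy]
      refine (hσ.stepp j hjy).imp_right ?_
      rintro ⟨i, hi, hi1, hi2⟩
      exact ⟨i, by omega, by rw [h1 _ (by omega), hi1], hi2⟩
    · obtain ⟨ha, hb⟩ := hcross (by omega)
      exact Or.inr ⟨x - 1, by omega, ha, by rw [show x - 1 + 1 = x by omega, hb]⟩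
    · exact Or.inl (by rw [h4 _ (by omega) hj, hc, bridgeCycle_p h (by omega) hj])
  · intro i hi i' hi' j j' hij hij' hs
    by_cases hix : x ≤ i
    · rw [hlast i hix hi j hij, hlast i' (hdom i hix hi i' hi' hs) hi' j' hij']
    · by_cases hix' : x ≤ i'
      · exact absurd (hdom i' hix' hi' i hi hs.symm) hix
      · rw [h1 i (by omega)] at hij
        rw [h1 i' (by omega)] at hij'
        rw [sameCycle_mul_iff_of_disjoint hd (hco i (by omega))] at hs
        exact hσ.uniq i (by omega) i' (by omega) j j' hij hij' hs

theorem IsChain.exists_peel (hσ : IsChain o p r s σ) (h : Enumerates o p r s) (hr : 0 < r) :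
    ∃ x < r, ∃ y < s, IsChain o p x y ((bridgeCycle o p x r y s)⁻¹ * σ) := by
  have hz := hσ.zero
  classical
  obtain ⟨y, ⟨hys, x, hx, hyx⟩, hmax⟩ : ∃ y, (y < s ∧ ∃ x < r, σ (p y) = o x) ∧
      ∀ j, y < j → j < s → ∀ i < r, σ (p j) ≠ o i := by
    set Q : ℕ → Prop := fun y => y < s ∧ ∃ x < r, σ (p y) = o x
    have hQ0 : Q 0 := ⟨by omega, 0, hr, hσ.first hr⟩
    refine ⟨Nat.findGreatest Q s, Nat.findGreatest_spec (P := Q) (Nat.zero_le s) hQ0, ?_⟩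
    intro j hj hjs i hi hji
    exact Nat.findGreatest_is_greatest hj hjs.le ⟨hjs, i, hi, hji⟩
  have hp : ∀ j, y ≤ j → j + 1 < s → σ (p (j + 1)) = p j := by
    intro j hj hjs
    obtain h' | ⟨i, hi, -, h'⟩ := hσ.stepp j hjs
    · exact h'
    · exact absurd h' (hmax _ (by omega) hjs _ hi)
  have hsp : ∀ k, y + k < s → σ.SameCycle (p (y + k)) (p y) := by
    intro k
    induction k with
    | zero => exact fun _ => Equiv.Perm.SameCycle.refl _ _
    | succ k ih =>
      intro hk
      rw [← Equiv.Perm.sameCycle_apply_left, ← add_assoc, hp _ (by omega) (by omega)]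
      exact ih (by omega)
  have hroot : σ.SameCycle (o (r - 1)) (o x) := by
    rw [← Equiv.Perm.sameCycle_apply_left, hσ.last hr, ← hyx, Equiv.Perm.sameCycle_apply_right]
    have := hsp (s - 1 - y) (by omega)
    rwa [show y + (s - 1 - y) = s - 1 by omega] at this
  have hso : ∀ k, x + k < r → σ.SameCycle (o (r - 1)) (o (x + k)) ∧
      (x + k + 1 < r → σ (o (x + k)) = o (x + k + 1)) := by
    intro k
    have key : ∀ i < r, σ.SameCycle (o (r - 1)) (o i) → i + 1 < r → σ (o i) = o (i + 1) := by
      intro i hi hs hir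
      obtain h' | ⟨j, -, h', -⟩ := hσ.stepo i hir
      · exact h'
      · have := hσ.uniq _ (by omega) _ hi _ _ (hσ.last hr) h' hs
        omega
    induction k with
    | zero => exact fun _ => ⟨hroot, key x hx hroot⟩
    | succ k ih =>
      intro hk
      obtain ⟨ha, hb⟩ := ih (by omega)
      have hs : σ.SameCycle (o (r - 1)) (o (x + (k + 1))) := by
        rw [← add_assoc, ← hb (by omega), Equiv.Perm.sameCycle_apply_right]
        exact ha
      exact ⟨hs, key _ hk hs⟩
  have ho : ∀ i, x ≤ i → i + 1 < r → σ (o i) = o (i + 1) := by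
    intro i hi hir
    have := (hso (i - x) (by omega)).2
    rw [show x + (i - x) = i by omega] at this
    exact this hir
  refine ⟨x, hx, y, hys, ?_⟩
  set c := bridgeCycle o p x r y s with hc
  have hco : ∀ i, x ≤ i → i < r → c (o i) = σ (o i) := by
    intro i hi hir
    by_cases hir' : i + 1 < r
    · rw [ho i hi hir', hc, bridgeCycle_o h hi hir']
    · obtain rfl : i = r - 1 := by omega
      rw [hσ.last hr, hc, bridgeCycle_o_last h hx hys]
  have hcp : ∀ j, y ≤ j → j < s → c (p j) = σ (p j) := by
    intro j hj hjs
    obtain rfl | hj' := eq_or_lt_of_le hj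
    · rw [hyx, hc, bridgeCycle_p_last h hx hys]
    · obtain ⟨j, rfl⟩ : ∃ k, j = k + 1 := ⟨j - 1, by omega⟩
      rw [hp j (by omega) hjs, hc, bridgeCycle_p h (by omega) hjs]
  have hcσ : ∀ z, c z = z ∨ c z = σ z := by
    intro z
    by_cases hzo : ∃ i, x ≤ i ∧ i < r ∧ o i = z
    · obtain ⟨i, hi, hir, rfl⟩ := hzo
      exact Or.inr (hco i hi hir)
    by_cases hzp : ∃ j, y ≤ j ∧ j < s ∧ p j = z
    · obtain ⟨j, hj, hjs, rfl⟩ := hzp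
      exact Or.inr (hcp j hj hjs)
    push Not at hzo hzp
    exact Or.inl (bridgeCycle_of_notMem hzo hzp)
  have hcσ' : ∀ z, c z = z → c (σ z) = σ z := by
    intro z hz
    rcases hcσ (σ z) with h' | h'
    · exact h'
    · have : c (c⁻¹ (σ z)) = c⁻¹ (σ z) ∨ c (c⁻¹ (σ z)) = σ (c⁻¹ (σ z)) := hcσ _
      rw [show c (c⁻¹ (σ z)) = σ z by simp] at this
      rcases this with h3 | h3
      · rw [Equiv.Perm.eq_inv_iff_eq] at h3
        exact h3
      · have h4 := σ.injective h3
        rw [Equiv.Perm.eq_inv_iff_eq, hz] at h4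
        rw [← h4, hz]
  have hcfix : ∀ z, c z = z → (c⁻¹ * σ) z = σ z := fun z hz => by
    rw [Equiv.Perm.mul_apply, Equiv.Perm.inv_eq_iff_eq, hcσ' z hz]
  have hceq : ∀ z, c z = σ z → (c⁻¹ * σ) z = z := fun z hz => by
    rw [Equiv.Perm.mul_apply, ← hz, Equiv.Perm.inv_eq_iff_eq]
  have hd : c.Disjoint (c⁻¹ * σ) := fun z => (hcσ z).imp_right (hceq z)
  have hfo : ∀ i < x, (c⁻¹ * σ) (o i) = σ (o i) := fun i hi =>
    hcfix _ (bridgeCycle_fix_o h hi hx)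
  have hfp : ∀ j < y, (c⁻¹ * σ) (p j) = σ (p j) := fun j hj =>
    hcfix _ (bridgeCycle_fix_p h hj hys)
  have hmovo : ∀ i < r, c (o i) = o i → i < x := fun i hi hci =>
    lt_of_not_ge fun hlt => bridgeCycle_o_ne h hys hlt hi hci
  have hmovp : ∀ j < s, c (p j) = p j → j < y := fun j hj hcj =>
    lt_of_not_ge fun hlt => bridgeCycle_p_ne h hx hlt hj hcj
  have hxy : x = 0 ↔ y = 0 := by
    constructor
    · rintro rfl
      rw [← hσ.first hr] at hyx
      exact h.p_inj _ hys _ (by omega) (σ.injective hyx)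
    · rintro rfl
      rw [hσ.first hr] at hyx
      exact h.o_inj _ hx _ hr hyx.symm
  refine ⟨?_, hxy, ?_, ?_, ?_, ?_, ?_⟩
  · intro z hzo hzp
    rcases hcσ z with hcz | hcz
    · rw [hcfix z hcz]
      refine hσ.fix z ?_ ?_
      · rintro i hi rfl
        exact hzo i (hmovo i hi hcz) rfl
      · rintro j hj rfl
        exact hzp j (hmovp j hj hcz) rfl
    · exact hceq z hcz
  · intro hx0
    rw [hfo _ (by omega)]
    obtain h' | ⟨i, hi, h', h''⟩ := hσ.stepp (y - 1) (by omega)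
    · rw [show y - 1 + 1 = y by omega, hyx] at h'
      exact absurd h' (h.ne _ _)
    · rw [show y - 1 + 1 = y by omega, hyx] at h''
      have := h.o_inj _ hx _ hi h''
      rw [← h', this, Nat.add_sub_cancel]
  · intro hx0
    rw [hfp _ (by omega), hσ.first hr]
  · intro i hi
    rw [hfo i (by omega)]
    obtain h' | ⟨j, hj, h', h''⟩ := hσ.stepo i (by omega)
    · exact Or.inl h'
    · have hjy : j < y := by
        refine hmovp j (by omega) ?_
        rw [← h']
        exact hcσ' _ (bridgeCycle_fix_o h (by omega) hx)
      have : j + 1 ≠ y := by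
        rintro rfl
        rw [hyx] at h''
        have := h.o_inj _ hx _ (by omega) h''
        omega
      exact Or.inr ⟨j, by omega, h', by rw [hfp _ (by omega), h'']⟩
  · intro j hj
    rw [hfp _ hj]
    obtain h' | ⟨i, hi, h', h''⟩ := hσ.stepp j (by omega)
    · exact Or.inl h'
    · have hix : i + 1 < x := by
        refine hmovo _ hi ?_
        rw [← h'']
        exact hcσ' _ (bridgeCycle_fix_p h hj hys)
      exact Or.inr ⟨i, hix, by rw [hfo _ (by omega), h'], h''⟩
  · intro i hi i' hi' j j' hij hij' hs
    rw [hfo i hi] at hij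
    rw [hfo i' hi'] at hij'
    rw [← sameCycle_mul_iff_of_disjoint hd (bridgeCycle_fix_o h hi hx), mul_inv_cancel_left] at hs
    exact hσ.uniq i (by omega) i' (by omega) j j' hij hij' hs

omit [DecidableEq α] in
theorem IsChain.eq_one (hσ : IsChain o p 0 0 σ) : σ = 1 :=
  Equiv.ext fun z => hσ.fix z (fun _ h => absurd h (Nat.not_lt_zero _))
    fun _ h => absurd h (Nat.not_lt_zero _)

omit [DecidableEq α] in
theorem isChain_one : IsChain o p 0 0 (1 : Equiv.Perm α) := by
  constructor <;> simp

variable [Fintype α]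

/-- The product of the signed Catalan weights of the cycles of `σ`. -/
noncomputable def cycleWeight (σ : Equiv.Perm α) : ℚ := (σ.cycleType.map signedCat).prod

theorem cycleWeight_mul {c : Equiv.Perm α} (hc : c.IsCycle) (h : c.Disjoint σ) :
    cycleWeight (c * σ) = signedCat c.support.card * cycleWeight σ := by
  simp [cycleWeight, h.cycleType_mul, hc.cycleType]

theorem IsChain.cycleOf_glue (hσ : IsChain o p x y σ) (h : Enumerates o p r s) (hx : x < r)
    (hy : y < s) :
    (bridgeCycle o p x r y s * σ).cycleOf (o (r - 1)) = bridgeCycle o p x r y s := by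
  rw [Equiv.Perm.cycleOf_mul_of_apply_right_eq_self (hσ.disjoint h).commute _
    (hσ.fix_o h (by omega) (by omega)), (isCycle_bridgeCycle h hx hy).cycleOf_eq]
  exact bridgeCycle_o_ne h hy (by omega) (by omega)

open Classical in
theorem sum_isChain (h : Enumerates o p r s) (hr : 0 < r) (φ : ℕ → ℚ) :
    ∑ σ with IsChain o p r s σ, φ (σ.cycleOf (o (r - 1))).support.card * cycleWeight σ =
      ∑ x ∈ Finset.range r, ∑ y ∈ Finset.range s, φ (r - x + (s - y)) *
        signedCat (r - x + (s - y)) * ∑ σ with IsChain o p x y σ, cycleWeight σ := by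
  simp_rw [Finset.mul_sum]
  rw [← Finset.sum_product', Finset.sum_sigma']
  symm
  refine Finset.sum_nbij (fun z => bridgeCycle o p z.1.1 r z.1.2 s * z.2) ?_ ?_ ?_ ?_
  · rintro ⟨⟨x, y⟩, σ⟩ hz
    simp only [Finset.mem_sigma, Finset.mem_product, Finset.mem_range, Finset.mem_filter,
      Finset.mem_univ, true_and] at hz ⊢
    exact hz.2.glue h hz.1.1 hz.1.2
  · rintro ⟨⟨x, y⟩, σ⟩ hz ⟨⟨x', y'⟩, σ'⟩ hz' heq
    simp only [Finset.coe_sigma, Set.mem_sigma_iff, Finset.mem_coe, Finset.mem_product,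
      Finset.mem_range, Finset.mem_filter, Finset.mem_univ, true_and] at hz hz' heq
    obtain ⟨⟨hx, hy⟩, hσ⟩ := hz
    obtain ⟨⟨hx', hy'⟩, hσ'⟩ := hz'
    have hc : bridgeCycle o p x r y s = bridgeCycle o p x' r y' s := by
      rw [← hσ.cycleOf_glue h hx hy, heq, hσ'.cycleOf_glue h hx' hy']
    have hxx : x = x' := by
      rcases lt_trichotomy x x' with hlt | rfl | hlt
      · exact absurd (hc ▸ bridgeCycle_fix_o h hlt hx') (bridgeCycle_o_ne h hy le_rfl hx)
      · rfl
      · exact absurd (hc ▸ bridgeCycle_fix_o h hlt hx) (bridgeCycle_o_ne h hy' le_rfl hx')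
    have hyy : y = y' := by
      rcases lt_trichotomy y y' with hlt | rfl | hlt
      · exact absurd (hc ▸ bridgeCycle_fix_p h hlt hy') (bridgeCycle_p_ne h hx le_rfl hy)
      · rfl
      · exact absurd (hc ▸ bridgeCycle_fix_p h hlt hy) (bridgeCycle_p_ne h hx' le_rfl hy')
    subst hxx hyy
    rw [mul_left_cancel heq]
  · intro σ hσ
    simp only [Finset.coe_filter, Finset.mem_univ, true_and, Set.mem_ofPred_eq] at hσ
    obtain ⟨x, hx, y, hy, hσ'⟩ := hσ.exists_peel h hr
    refine ⟨⟨(x, y), (bridgeCycle o p x r y s)⁻¹ * σ⟩, ?_, mul_inv_cancel_left _ _⟩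
    simp [hx, hy, hσ']
  · rintro ⟨⟨x, y⟩, σ⟩ hz
    simp only [Finset.mem_sigma, Finset.mem_product, Finset.mem_range, Finset.mem_filter,
      Finset.mem_univ, true_and] at hz ⊢
    obtain ⟨⟨hx, hy⟩, hσ⟩ := hz
    rw [hσ.cycleOf_glue h hx hy, cycleWeight_mul (isCycle_bridgeCycle h hx hy) (hσ.disjoint h),
      card_support_bridgeCycle h hx hy, mul_assoc]

open Classical in
theorem sum_cycleWeight_isChain {T : ℕ → ℕ → ℚ} (hT0 : T 0 0 = 1)
    (hT : ∀ r s, ¬(r = 0 ∧ s = 0) → T r s = ∑ x ∈ Finset.range r, ∑ y ∈ Finset.range s,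
      signedCat (r - x + (s - y)) * T x y) (h : Enumerates o p r s) :
    ∑ σ : Equiv.Perm α with IsChain o p r s σ, cycleWeight σ = T r s := by
  induction r using Nat.strong_induction_on generalizing s with
  | _ r ih =>
    rcases Nat.eq_zero_or_pos r with rfl | hr
    · rcases Nat.eq_zero_or_pos s with rfl | hs
      · have : (Finset.univ.filter fun σ : Equiv.Perm α => IsChain o p 0 0 σ) = {1} := by
          ext σ
          simp only [Finset.mem_filter, Finset.mem_univ, true_and, Finset.mem_singleton]
          exact ⟨IsChain.eq_one, fun h1 => h1 ▸ isChain_one⟩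
        rw [this, Finset.sum_singleton, hT0, cycleWeight]
        simp
      · rw [hT 0 s (by omega), Finset.filter_eq_empty_iff.2]
        · simp
        · intro σ _ hσ
          have := hσ.zero
          omega
    · have := sum_isChain h hr fun _ => 1
      simp only [one_mul] at this
      rw [this, hT r s (by omega)]
      refine Finset.sum_congr rfl fun x hx => Finset.sum_congr rfl fun y hy => ?_
      rw [Finset.mem_range] at hx hy
      rw [ih x hx (h.mono hx.le hy.le)]

open Classical in
theorem sum_card_mul_cycleWeight_isChain (h : Enumerates o p r s) (hr : 1 ≤ r) (hs : 1 ≤ s) :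
    ∑ σ : Equiv.Perm α with IsChain o p r s σ,
      ((σ.cycleOf (o (r - 1))).support.card : ℚ) * cycleWeight σ =
        (-1) ^ (r + s - 1) * (r.centralBinom * s.centralBinom / 2) := by
  obtain ⟨T, hT0, hT, hT'⟩ := exists_chain_weight
  rw [sum_isChain h hr fun n => (n : ℚ), ← hT' r s hr hs]
  refine Finset.sum_congr rfl fun x hx => Finset.sum_congr rfl fun y hy => ?_
  rw [Finset.mem_range] at hx hy
  rw [sum_cycleWeight_isChain hT0 hT (h.mono hx.le hy.le)]

end Chains

section Orbits

variable {α : Type*} [Fintype α]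

noncomputable instance (σ : Equiv.Perm α) : Fintype (Quotient (orbitSetoid σ)) :=
  Fintype.ofFinite _

omit [Fintype α] in
theorem orbit_mk_eq_iff {σ : Equiv.Perm α} {x y : α} :
    (Quotient.mk (orbitSetoid σ) x = Quotient.mk (orbitSetoid σ) y) ↔ σ.SameCycle x y :=
  Quotient.eq

omit [Fintype α] in
theorem orbitSize_mk_of_fixed {σ : Equiv.Perm α} {x : α} (hx : σ x = x) :
    orbitSize σ (Quotient.mk _ x) = 1 := by
  rw [orbitSize, Nat.card_eq_one_iff_unique]
  refine ⟨⟨fun a b => Subtype.ext ?_⟩, ⟨⟨x, rfl⟩⟩⟩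
  have ha := orbit_mk_eq_iff.1 a.2
  have hb := orbit_mk_eq_iff.1 b.2
  rw [← ha.symm.eq_of_left hx, ← hb.symm.eq_of_left hx]

theorem orbitSize_mk [DecidableEq α] {σ : Equiv.Perm α} {x : α} (hx : σ x ≠ x) :
    orbitSize σ (Quotient.mk _ x) = (σ.cycleOf x).support.card := by
  rw [orbitSize, ← Fintype.card_coe, ← Nat.card_eq_fintype_card]
  refine Nat.card_congr (Equiv.subtypeEquivRight fun y => ?_)
  rw [orbit_mk_eq_iff, Equiv.Perm.mem_support_cycleOf_iff' hx,
    Equiv.Perm.sameCycle_comm]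

theorem orbitSize_eq_one_iff {σ : Equiv.Perm α} {x : α} :
    orbitSize σ (Quotient.mk _ x) = 1 ↔ σ x = x := by
  classical
  refine ⟨fun h => ?_, orbitSize_mk_of_fixed⟩
  by_contra hx
  rw [orbitSize_mk hx] at h
  have := (Equiv.Perm.isCycle_cycleOf σ hx).two_le_card_support
  omega

theorem sum_orbitSize (σ : Equiv.Perm α) :
    ∑ c : Quotient (orbitSetoid σ), orbitSize σ c = Fintype.card α := by
  rw [← Nat.card_eq_fintype_card,
    ← Nat.card_congr (Equiv.sigmaFiberEquiv (Quotient.mk (orbitSetoid σ))),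
    Nat.card_sigma]
  rfl

theorem prod_orbitSize [DecidableEq α] {M : Type*} [CommMonoid M] (σ : Equiv.Perm α) (f : ℕ → M) :
    ∏ c : Quotient (orbitSetoid σ), f (orbitSize σ c) =
      f 1 ^ (Fintype.card α - σ.support.card) * (σ.cycleType.map f).prod := by
  classical
  rw [← Finset.prod_filter_mul_prod_filter_not _ (fun c => orbitSize σ c = 1)]
  congr 1
  · rw [Finset.prod_congr rfl (g := fun _ => f 1) (fun c hc => by rw [(Finset.mem_filter.1 hc).2]),
      Finset.prod_const, ← Finset.card_compl]
    congr 1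
    symm
    refine Finset.card_bij (fun x _ => Quotient.mk _ x) ?_ ?_ ?_
    · intro x hx
      simp only [Finset.mem_compl, Equiv.Perm.mem_support, not_not] at hx
      simpa using orbitSize_mk_of_fixed hx
    · intro x hx y _ hxy
      simp only [Finset.mem_compl, Equiv.Perm.mem_support, not_not] at hx
      exact (orbit_mk_eq_iff.1 hxy).eq_of_left hx
    · intro c hc
      induction c using Quotient.inductionOn with | _ x =>
      refine ⟨x, ?_, rfl⟩
      simpa using orbitSize_eq_one_iff.1 (Finset.mem_filter.1 hc).2
  · rw [Equiv.Perm.cycleType_def, Multiset.map_map, ← Finset.prod_eq_multiset_prod]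
    have key : ∀ c : Quotient (orbitSetoid σ), orbitSize σ c ≠ 1 → σ c.out ≠ c.out := by
      intro c hc h
      rw [← orbitSize_eq_one_iff, Quotient.out_eq] at h
      exact hc h
    refine Finset.prod_bij (fun c _ => σ.cycleOf c.out) ?_ ?_ ?_ ?_
    · intro c hc
      rw [Equiv.Perm.cycleOf_mem_cycleFactorsFinset_iff, Equiv.Perm.mem_support]
      exact key c (Finset.mem_filter.1 hc).2
    · intro c hc d hd h
      have := (Equiv.Perm.sameCycle_iff_cycleOf_eq_of_mem_support
        (Equiv.Perm.mem_support.2 (key c (Finset.mem_filter.1 hc).2))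
        (Equiv.Perm.mem_support.2 (key d (Finset.mem_filter.1 hd).2))).2 h
      rw [← orbit_mk_eq_iff] at this
      simpa using this
    · intro g hg
      obtain ⟨hcyc, hg'⟩ := Equiv.Perm.mem_cycleFactorsFinset_iff.1 hg
      obtain ⟨x, hx, -⟩ := id hcyc
      have hxs : x ∈ g.support := Equiv.Perm.mem_support.2 hx
      have hx0 : σ x ≠ x := by rw [← hg' x hxs]; exact hx
      refine ⟨Quotient.mk _ x, ?_, ?_⟩
      · rw [Finset.mem_filter]
        exact ⟨Finset.mem_univ _, fun h => hx0 (orbitSize_eq_one_iff.1 h)⟩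
      · have : σ.SameCycle (Quotient.mk (orbitSetoid σ) x).out x := by
          rw [← orbit_mk_eq_iff, Quotient.out_eq]
        rw [this.cycleOf_eq]
        exact (Equiv.Perm.cycle_is_cycleOf hxs hg).symm
    · intro c hc
      have := orbitSize_mk (key c (Finset.mem_filter.1 hc).2)
      rw [Quotient.out_eq] at this
      rw [this]
      rfl

theorem numOrbits_eq [DecidableEq α] (σ : Equiv.Perm α) :
    numOrbits σ = Fintype.card α - σ.support.card + σ.cycleType.card := by
  have := prod_orbitSize σ (fun _ => 2)
  simp only [Finset.prod_const, Finset.card_univ, Multiset.map_const', Multiset.prod_replicate,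
    ← pow_add] at this
  rw [numOrbits, Nat.card_eq_fintype_card]
  exact Nat.pow_right_injective le_rfl this

theorem two_mul_card_cycleType_le [DecidableEq α] (σ : Equiv.Perm α) :
    2 * σ.cycleType.card ≤ σ.support.card := by
  rw [← Equiv.Perm.sum_cycleType, mul_comm, ← smul_eq_mul]
  exact Multiset.card_nsmul_le_sum fun x hx => Equiv.Perm.two_le_of_mem_cycleType hx

theorem two_mul_card_cycleType_eq_iff [DecidableEq α] (σ : Equiv.Perm α) :
    2 * σ.cycleType.card = σ.support.card ↔ σ * σ = 1 := by
  rw [← pow_two, ← orderOf_dvd_iff_pow_eq_one, ← Equiv.Perm.lcm_cycleType, Multiset.lcm_dvd,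
    ← Equiv.Perm.sum_cycleType]
  have h2 := fun x (hx : x ∈ σ.cycleType) => Equiv.Perm.two_le_of_mem_cycleType hx
  revert h2
  induction σ.cycleType using Multiset.induction_on with
  | empty => simp
  | cons a t ih =>
    intro h2
    have ht : t.card • 2 ≤ t.sum :=
      Multiset.card_nsmul_le_sum fun x hx => h2 x (Multiset.mem_cons_of_mem hx)
    have ha := h2 a (Multiset.mem_cons_self a t)
    have ih := ih fun x hx => h2 x (Multiset.mem_cons_of_mem hx)
    rw [smul_eq_mul] at ht
    simp only [Multiset.card_cons, Multiset.sum_cons, Multiset.forall_mem_cons, ← ih]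
    constructor
    · intro h
      refine ⟨?_, by omega⟩
      rw [show a = 2 by omega]
    · rintro ⟨had, h⟩
      have := Nat.le_of_dvd two_pos had
      omega

theorem catProd_eq_cycleWeight [DecidableEq α] (σ : Equiv.Perm α) :
    (catProd σ : ℚ) = cycleWeight σ := by
  rw [catProd, finprod_eq_prod_of_fintype, cycleWeight]
  push_cast
  refine (prod_orbitSize σ signedCat).trans ?_
  simp [signedCat]

end Orbits

section Bridging

variable {α : Type*}

/-- `σ` consists of bridges between `S` and its complement; each cycle runs along `τ` on `S`,
crosses once, runs along `τ` on the complement of `S` and crosses back. -/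
structure IsBridging (S : α → Prop) (τ σ : Equiv.Perm α) : Prop where
  follow : ∀ z, (S z ↔ S (σ z)) → σ z = τ z
  swap : ∀ z w, σ z = τ w → σ w = τ z
  uniq : ∀ z z', S z → ¬ S (σ z) → S z' → ¬ S (σ z') → σ.SameCycle z z' → z = z'
  meets : ∀ z, ∃ a b, σ.SameCycle z a ∧ σ.SameCycle z b ∧ S a ∧ ¬ S b

variable {S : α → Prop} {τ σ : Equiv.Perm α}

theorem exists_crossing [Finite α] {a b : α} (h : σ.SameCycle a b) (ha : S a) (hb : ¬ S b) :
    ∃ z, σ.SameCycle a z ∧ S z ∧ ¬ S (σ z) := by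
  by_contra! hc
  obtain ⟨n, rfl⟩ := h.exists_nat_pow_eq
  refine hb ?_
  clear hb h
  induction n with
  | zero => exact ha
  | succ n ih =>
    rw [pow_succ', Equiv.Perm.mul_apply]
    exact hc _ ⟨n, by simp⟩ ih

variable [Fintype α]

theorem surjective_crossing (h : ∀ z, ∃ a b, σ.SameCycle z a ∧ σ.SameCycle z b ∧ S a ∧ ¬ S b) :
    Function.Surjective fun z : {z // S z ∧ ¬ S (σ z)} => Quotient.mk (orbitSetoid σ) z := by
  intro c
  induction c using Quotient.inductionOn with | _ x =>
  obtain ⟨a, b, ha, hb, hSa, hSb⟩ := h x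
  obtain ⟨z, hz, hz1, hz2⟩ := exists_crossing (ha.symm.trans hb) hSa hSb
  exact ⟨⟨z, hz1, hz2⟩, orbit_mk_eq_iff.2 (ha.trans hz).symm⟩

theorem IsBridging.bijective_crossing (h : IsBridging S τ σ) :
    Function.Bijective fun z : {z // S z ∧ ¬ S (σ z)} => Quotient.mk (orbitSetoid σ) z :=
  ⟨fun z w hzw => Subtype.ext (h.uniq _ _ z.2.1 z.2.2 w.2.1 w.2.2 (orbit_mk_eq_iff.1 hzw)),
    surjective_crossing h.meets⟩

theorem numOrbits_add_numOrbits_eq_iff (hτ : ∀ z, S (τ z) ↔ S z)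
    (h : ∀ z, ∃ a b, σ.SameCycle z a ∧ σ.SameCycle z b ∧ S a ∧ ¬ S b) :
    numOrbits σ + numOrbits (σ⁻¹ * τ) = Fintype.card α ↔ IsBridging S τ σ := by
  classical
  set K := σ⁻¹ * τ with hK
  have hKz : ∀ z w, K z = w ↔ σ w = τ z := fun z w => by
    rw [hK, Equiv.Perm.mul_apply, Equiv.Perm.inv_eq_iff_eq, eq_comm]
  let A := Finset.univ.filter fun z => S z ∧ ¬ S (σ z)
  let B := Finset.univ.filter fun z => ¬ S z ∧ ¬ ¬ S (σ z)
  have hAB : Disjoint A B := by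
    rw [Finset.disjoint_filter]
    tauto
  have hsub : A ∪ B ⊆ K.support := by
    intro z hz
    rw [Equiv.Perm.mem_support, Ne, hKz]
    intro h'
    have := hτ z
    rw [← h'] at this
    simp only [A, B, Finset.mem_union, Finset.mem_filter, Finset.mem_univ, true_and] at hz
    tauto
  have hsurj := surjective_crossing h
  have hsurj' := surjective_crossing (S := fun z => ¬ S z) (σ := σ) fun z => by
    obtain ⟨a, b, h1, h2, h3, h4⟩ := h z
    exact ⟨b, a, h2, h1, h4, not_not.2 h3⟩
  have hA : numOrbits σ ≤ A.card := by
    rw [numOrbits, Nat.card_eq_fintype_card, ← Fintype.card_subtype]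
    exact Fintype.card_le_of_surjective _ hsurj
  have hB : numOrbits σ ≤ B.card := by
    rw [numOrbits, Nat.card_eq_fintype_card, ← Fintype.card_subtype]
    exact Fintype.card_le_of_surjective _ hsurj'
  have hm := Finset.card_le_card hsub
  rw [Finset.card_union_of_disjoint hAB] at hm
  have hle := two_mul_card_cycleType_le K
  have hn := K.support.card_le_univ
  rw [numOrbits_eq K]
  constructor
  · intro he
    have hAe : A.card = numOrbits σ := by omega
    have hinv : K * K = 1 := (two_mul_card_cycleType_eq_iff K).1 (by omega)
    have hsupp : A ∪ B = K.support := Finset.eq_of_subset_of_card_le hsub (by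
      rw [Finset.card_union_of_disjoint hAB]; omega)
    refine ⟨fun z hz => ?_, fun z w hzw => ?_, fun z z' h1 h2 h1' h2' hs => ?_, h⟩
    · rw [← hKz]
      by_contra hne
      have : z ∈ A ∪ B := hsupp ▸ Equiv.Perm.mem_support.2 hne
      simp only [A, B, Finset.mem_union, Finset.mem_filter, Finset.mem_univ, true_and] at this
      tauto
    · rw [← hKz] at hzw ⊢
      rw [← hzw, ← Equiv.Perm.mul_apply, hinv, Equiv.Perm.one_apply]
    · have hbij := (Fintype.bijective_iff_surjective_and_card _).2 ⟨hsurj, by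
        rw [Fintype.card_subtype, ← Nat.card_eq_fintype_card (α := Quotient _)]; exact hAe⟩
      exact congrArg Subtype.val (hbij.1 (a₁ := ⟨z, h1, h2⟩) (a₂ := ⟨z', h1', h2'⟩)
        (orbit_mk_eq_iff.2 hs))
  · intro hb
    have hAe : A.card = numOrbits σ := by
      rw [numOrbits, Nat.card_eq_fintype_card, ← Fintype.card_subtype]
      exact Fintype.card_of_bijective hb.bijective_crossing
    have hinv : K * K = 1 := by
      ext1 z
      rw [Equiv.Perm.mul_apply, Equiv.Perm.one_apply, hKz]
      exact hb.swap _ _ ((hKz z _).1 rfl)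
    have hsupp : A ∪ B = K.support := by
      refine hsub.antisymm fun z hz => ?_
      rw [Equiv.Perm.mem_support, Ne, hKz] at hz
      have := fun h => hz (hb.follow z h)
      simp only [A, B, Finset.mem_union, Finset.mem_filter, Finset.mem_univ, true_and]
      tauto
    have hBA : B.card ≤ A.card := by
      refine Finset.card_le_card_of_injOn K (fun z hz => ?_) K.injective.injOn
      simp only [A, B, Finset.coe_filter, Finset.mem_univ, true_and, Set.mem_ofPred_eq,
        not_not] at hz ⊢
      have h1 := (hKz z _).1 rfl
      have h2 := hb.swap _ _ h1
      have h3 := hτ z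
      have h4 := hτ (K z)
      rw [← h1] at h3
      rw [← h2] at h4
      tauto
    have := (two_mul_card_cycleType_eq_iff K).2 hinv
    have h5 := congrArg Finset.card hsupp
    rw [Finset.card_union_of_disjoint hAB] at h5
    omega

theorem IsBridging.sum_card_support [DecidableEq α] [DecidablePred fun z => S z ∧ ¬ S (σ z)]
    (h : IsBridging S τ σ) :
    ∑ z with S z ∧ ¬ S (σ z), (σ.cycleOf z).support.card = Fintype.card α := by
  rw [← sum_orbitSize σ, ← h.bijective_crossing.sum_comp,
    Finset.sum_subtype _ (p := fun z => S z ∧ ¬ S (σ z)) (by simp)]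
  refine Finset.sum_congr rfl fun z _ => (orbitSize_mk fun hz => ?_).symm
  have := z.2
  rw [hz] at this
  tauto

end Bridging

section Unwinding

variable {α : Type*} {τ σ : Equiv.Perm α}

theorem isBridging_and_iff_isChain {S : α → Prop} {o p : ℕ → α} {r s : ℕ}
    (h : Enumerates o p r s) (hr : 1 ≤ r) (hs : 1 ≤ s) (ho : ∀ i, S (o i)) (hp : ∀ j, ¬ S (p j))
    (ho' : ∀ z, S z → ∃ i < r, o i = z) (hp' : ∀ z, ¬ S z → ∃ j < s, p j = z)
    (hor : o r = o 0) (hps : p s = p 0)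
    (hτo : ∀ i, τ (o i) = o (i + 1)) (hτp : ∀ j, τ (p (j + 1)) = p j) :
    IsBridging S τ σ ∧ σ (o (r - 1)) = p (s - 1) ↔ IsChain o p r s σ := by
  have hτo' : τ (o (r - 1)) = o 0 := by rw [hτo, Nat.sub_add_cancel hr, hor]
  have hτp' : τ (p 0) = p (s - 1) := by rw [← hps, ← hτp (s - 1), Nat.sub_add_cancel hs]
  constructor
  · rintro ⟨hb, hlast⟩
    have hfirst : σ (p 0) = o 0 := (hb.swap _ _ (hlast.trans hτp'.symm)).trans hτo'
    refine ⟨fun z h1 h2 => ?_, by omega, fun _ => hlast, fun _ => hfirst, fun i hi => ?_,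
      fun j hj => ?_, fun i hi i' hi' j j' h1 h2 hc => ?_⟩
    · by_cases hz : S z
      · obtain ⟨i, hi, hz⟩ := ho' z hz
        exact absurd hz (h1 i hi)
      · obtain ⟨i, hi, hz⟩ := hp' z hz
        exact absurd hz (h2 i hi)
    · by_cases hz : S (σ (o i))
      · exact Or.inl ((hb.follow _ (by simp [ho, hz])).trans (hτo i))
      · obtain ⟨j, hj, hjz⟩ := hp' _ hz
        refine Or.inr ⟨j, ?_, hjz.symm, ?_⟩
        · by_contra hjs
          obtain rfl : j = s - 1 := by omega
          have := h.o_inj _ (by omega) _ (by omega) (σ.injective (hlast.trans hjz))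
          omega
        · rw [← hτo]
          exact hb.swap _ _ (by rw [hτp, hjz])
    · by_cases hz : S (σ (p (j + 1)))
      · obtain ⟨i, hi, hiz⟩ := ho' _ hz
        cases i with
        | zero =>
          have := h.p_inj _ (by omega) _ hj (σ.injective (hfirst.trans hiz))
          omega
        | succ i =>
          refine Or.inr ⟨i, hi, ?_, hiz.symm⟩
          rw [← hτp]
          exact hb.swap _ _ (by rw [hτo, hiz])
      · exact Or.inl ((hb.follow _ (by simp [hp, hz])).trans (hτp j))
    · exact h.o_inj _ hi _ hi' (hb.uniq _ _ (ho i) (h1 ▸ hp j) (ho i') (h2 ▸ hp j') hc)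
  · intro hc
    have hlast := hc.last hr
    have hfirst := hc.first hr
    refine ⟨⟨fun z hz => ?_, fun z w hzw => ?_, fun z z' h1 h2 h1' h2' hzz => ?_, fun z => ?_⟩,
      hlast⟩
    · by_cases hSz : S z
      · obtain ⟨i, hi, rfl⟩ := ho' z hSz
        have hSi := hz.1 hSz
        rcases Nat.lt_or_ge (i + 1) r with hir | hir
        · rcases hc.stepo i hir with h1 | ⟨j, -, h1, -⟩
          · rw [h1, hτo]
          · exact absurd (h1 ▸ hSi) (hp j)
        · obtain rfl : i = r - 1 := by omega
          exact absurd (hlast ▸ hSi) (hp _)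
      · obtain ⟨j, hj, rfl⟩ := hp' z hSz
        have hSj := mt hz.2 hSz
        cases j with
        | zero => exact absurd (ho 0) (hfirst ▸ hSj)
        | succ j =>
          rcases hc.stepp j hj with h1 | ⟨i, -, -, h1⟩
          · rw [h1, hτp]
          · exact absurd (ho _) (h1 ▸ hSj)
    · by_cases hSz : S z
      · obtain ⟨i, hi, rfl⟩ := ho' z hSz
        rcases Nat.lt_or_ge (i + 1) r with hir | hir
        · rcases hc.stepo i hir with h1 | ⟨j, -, h1, h2⟩
          · rw [h1, ← hτo] at hzw
            rw [← τ.injective hzw, h1, hτo]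
          · rw [h1, ← hτp] at hzw
            rw [← τ.injective hzw, h2, hτo]
        · obtain rfl : i = r - 1 := by omega
          rw [hlast, ← hτp'] at hzw
          rw [← τ.injective hzw, hfirst, hτo']
      · obtain ⟨j, hj, rfl⟩ := hp' z hSz
        cases j with
        | zero =>
          rw [hfirst, ← hτo'] at hzw
          rw [← τ.injective hzw, hlast, hτp']
        | succ j =>
          rcases hc.stepp j hj with h1 | ⟨i, -, h1, h2⟩
          · rw [h1, ← hτp] at hzw
            rw [← τ.injective hzw, h1, hτp]
          · rw [h2, ← hτo] at hzw
            rw [← τ.injective hzw, h1, hτp]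
    · obtain ⟨i, hi, rfl⟩ := ho' z h1
      obtain ⟨i', hi', rfl⟩ := ho' z' h1'
      obtain ⟨j, hj, hj'⟩ := hp' _ h2
      obtain ⟨k, hk, hk'⟩ := hp' _ h2'
      rw [hc.uniq i hi i' hi' j k hj'.symm hk'.symm hzz]
    · by_cases hSz : S z
      · obtain ⟨i, hi, rfl⟩ := ho' z hSz
        have key : ∀ k i, i + k + 1 = r → ∃ j, σ.SameCycle (o i) (p j) := by
          intro k
          induction k with
          | zero =>
            intro i hi
            obtain rfl : i = r - 1 := by omega
            exact ⟨_, hlast ▸ (Equiv.Perm.SameCycle.refl σ _).apply_right⟩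
          | succ k ih =>
            intro i hi
            rcases hc.stepo i (by omega) with h1 | ⟨j, -, h1, -⟩
            · obtain ⟨j, hj⟩ := ih (i + 1) (by omega)
              exact ⟨j, Equiv.Perm.sameCycle_apply_left.1 (h1 ▸ hj)⟩
            · exact ⟨j, h1 ▸ (Equiv.Perm.SameCycle.refl σ _).apply_right⟩
        obtain ⟨j, hj⟩ := key (r - 1 - i) i (by omega)
        exact ⟨_, _, .refl _ _, hj, hSz, hp j⟩
      · obtain ⟨j, hj, rfl⟩ := hp' z hSz
        have key : ∀ j, j < s → ∃ i, σ.SameCycle (p j) (o i) := by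
          intro j
          induction j with
          | zero => exact fun _ => ⟨0, hfirst ▸ (Equiv.Perm.SameCycle.refl σ _).apply_right⟩
          | succ j ih =>
            intro hj
            rcases hc.stepp j hj with h1 | ⟨i, -, -, h1⟩
            · obtain ⟨i, hi⟩ := ih (by omega)
              exact ⟨i, Equiv.Perm.sameCycle_apply_left.1 (h1 ▸ hi)⟩
            · exact ⟨_, h1 ▸ (Equiv.Perm.SameCycle.refl σ _).apply_right⟩
        obtain ⟨i, hi⟩ := key j hj
        exact ⟨_, _, hi, .refl _ _, ho i, hSz⟩

variable [Fintype α] [DecidableEq α] {S : Finset α}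

theorem enumerates_pow (hS : τ.IsCycleOn (S : Set α)) (hS' : τ.IsCycleOn ((Sᶜ : Finset α) : Set α))
    {x y : α} (hx : x ∈ S) (hy : y ∈ Sᶜ) :
    Enumerates (fun i => (τ ^ (i + 1)) x) (fun j => (τ⁻¹ ^ j) y) S.card Sᶜ.card where
  o_inj i hi j hj h := by
    have := (hS.pow_apply_eq_pow_apply hx).1 h
    exact (Nat.ModEq.add_right_cancel' 1 this).eq_of_lt_of_lt hi hj
  p_inj i hi j hj h := ((hS'.inv.pow_apply_eq_pow_apply hy).1 h).eq_of_lt_of_lt hi hj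
  ne i j h := by
    have h1 : (τ ^ (i + 1)) x ∈ (S : Set α) := (hS.1.perm_pow (i + 1)).mapsTo hx
    have h2 : (τ⁻¹ ^ j) y ∈ ((Sᶜ : Finset α) : Set α) := (hS'.inv.1.perm_pow j).mapsTo hy
    rw [Finset.mem_coe] at h1 h2
    exact Finset.mem_compl.1 h2 (h ▸ h1)

theorem isBridging_and_apply_eq_iff (hS : τ.IsCycleOn (S : Set α))
    (hS' : τ.IsCycleOn ((Sᶜ : Finset α) : Set α)) {x y : α} (hx : x ∈ S) (hy : y ∈ Sᶜ) :
    IsBridging (· ∈ S) τ σ ∧ σ x = τ y ↔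
      IsChain (fun i => (τ ^ (i + 1)) x) (fun j => (τ⁻¹ ^ j) y) S.card Sᶜ.card σ := by
  have hr : 1 ≤ S.card := Finset.card_pos.2 ⟨x, hx⟩
  have hs : 1 ≤ Sᶜ.card := Finset.card_pos.2 ⟨y, hy⟩
  have h1 : (τ ^ S.card) x = x := hS.pow_card_apply hx
  have h2 : (τ⁻¹ ^ Sᶜ.card) y = y := hS'.inv.pow_card_apply hy
  have hp (j : ℕ) : τ ((τ⁻¹ ^ (j + 1)) y) = (τ⁻¹ ^ j) y := by
    rw [pow_succ', Equiv.Perm.mul_apply]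
    simp
  rw [← isBridging_and_iff_isChain (S := (· ∈ S)) (τ := τ) (enumerates_pow hS hS' hx hy) hr hs]
  · have h3 := hp (Sᶜ.card - 1)
    rw [Nat.sub_add_cancel hs, h2] at h3
    rw [Nat.sub_add_cancel hr, h1, h3]
  · exact fun i => (hS.1.perm_pow (i + 1)).mapsTo hx
  · exact fun j => Finset.mem_compl.1 ((hS'.inv.1.perm_pow j).mapsTo hy)
  · intro z hz
    obtain ⟨n, hn, hz⟩ := hS.exists_pow_eq (hS.1.mapsTo hx) hz
    exact ⟨n, hn, by rw [← hz, pow_succ, Equiv.Perm.mul_apply]⟩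
  · intro z hz
    exact hS'.inv.exists_pow_eq hy (Finset.mem_compl.2 hz)
  · rw [pow_succ', Equiv.Perm.mul_apply, h1, zero_add, pow_one]
  · rw [h2, pow_zero, Equiv.Perm.one_apply]
  · exact fun i => by rw [pow_succ' τ (i + 1), Equiv.Perm.mul_apply]
  · exact hp

open Classical in
theorem card_mul_sum_isBridging (hS : τ.IsCycleOn (S : Set α))
    (hS' : τ.IsCycleOn ((Sᶜ : Finset α) : Set α)) :
    (Fintype.card α : ℚ) * ∑ σ : Equiv.Perm α with IsBridging (· ∈ S) τ σ, cycleWeight σ =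
      S.card * Sᶜ.card * ((-1) ^ (S.card + Sᶜ.card - 1) *
        (S.card.centralBinom * Sᶜ.card.centralBinom / 2)) := by
  have h1 : ∀ σ : Equiv.Perm α, IsBridging (· ∈ S) τ σ → (Fintype.card α : ℚ) * cycleWeight σ =
      ∑ x ∈ S, ∑ y ∈ Sᶜ,
        if σ x = τ y then ((σ.cycleOf x).support.card : ℚ) * cycleWeight σ else 0 := by
    intro σ hσ
    rw [← hσ.sum_card_support, Nat.cast_sum, Finset.sum_mul, ← Finset.filter_filter,
      Finset.sum_filter, Finset.filter_mem_eq_inter, Finset.univ_inter]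
    refine Finset.sum_congr rfl fun x _ => ?_
    simp_rw [← Equiv.Perm.inv_eq_iff_eq (f := τ), Finset.sum_ite_eq]
    refine if_congr ?_ rfl rfl
    rw [Finset.mem_compl, not_iff_not]
    have := hS.apply_mem_iff (x := τ⁻¹ (σ x))
    simpa using this
  rw [Finset.mul_sum, Finset.sum_congr rfl fun σ hσ => h1 σ (Finset.mem_filter.1 hσ).2,
    Finset.sum_comm, Finset.sum_congr rfl fun x _ => Finset.sum_comm]
  have h2 : ∀ x ∈ S, ∀ y ∈ Sᶜ, ∑ σ : Equiv.Perm α with IsBridging (· ∈ S) τ σ,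
      (if σ x = τ y then ((σ.cycleOf x).support.card : ℚ) * cycleWeight σ else 0) =
      (-1) ^ (S.card + Sᶜ.card - 1) * (S.card.centralBinom * Sᶜ.card.centralBinom / 2) := by
    intro x hx y hy
    have hr : 1 ≤ S.card := Finset.card_pos.2 ⟨x, hx⟩
    have hs : 1 ≤ Sᶜ.card := Finset.card_pos.2 ⟨y, hy⟩
    rw [← sum_card_mul_cycleWeight_isChain (enumerates_pow hS hS' hx hy) hr hs,
      ← Finset.sum_filter, Finset.filter_filter]
    simp_rw [isBridging_and_apply_eq_iff hS hS' hx hy]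
    rw [Nat.sub_add_cancel hr, hS.pow_card_apply hx]
  rw [Finset.sum_congr rfl fun x hx => Finset.sum_congr rfl fun y hy => h2 x hx y hy]
  simp only [Finset.sum_const, nsmul_eq_mul, mul_assoc]

end Unwinding

section Annulus

variable {α : Type*} {τ σ : Equiv.Perm α} {S : Finset α}

theorem sameCycle_mem_iff {T : Set α} (hT : τ.IsCycleOn T) {x y : α} (h : τ.SameCycle x y) :
    x ∈ T ↔ y ∈ T := by
  obtain ⟨n, rfl⟩ := h
  constructor
  · exact fun hx => (hT.1.perm_zpow n).mapsTo hx
  · intro hy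
    have := (hT.1.perm_zpow (-n)).mapsTo hy
    simpa [zpow_neg] using this

theorem numOrbits_eq_two [Fintype α] [DecidableEq α] (hS : τ.IsCycleOn (S : Set α))
    (hS' : τ.IsCycleOn ((Sᶜ : Finset α) : Set α)) (hr : S.Nonempty) (hs : Sᶜ.Nonempty) :
    numOrbits τ = 2 := by
  obtain ⟨a, ha⟩ := hr
  obtain ⟨b, hb⟩ := hs
  rw [numOrbits, Nat.card_eq_two_iff]
  refine ⟨Quotient.mk _ a, Quotient.mk _ b, fun h => ?_, ?_⟩
  · rw [orbit_mk_eq_iff] at h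
    exact Finset.mem_compl.1 hb ((sameCycle_mem_iff hS h).1 ha)
  · refine Set.eq_univ_of_forall fun c => ?_
    induction c using Quotient.inductionOn with | _ x =>
    simp only [Set.mem_insert_iff, Set.mem_singleton_iff, orbit_mk_eq_iff]
    by_cases hx : x ∈ S
    · exact Or.inl (hS.2 hx ha)
    · exact Or.inr (hS'.2 (Finset.mem_coe.2 (Finset.mem_compl.2 hx)) hb)

theorem numJoin_eq_one (hS : τ.IsCycleOn (S : Set α)) (hr : S.Nonempty)
    (h : ∀ z, ∃ a b, σ.SameCycle z a ∧ σ.SameCycle z b ∧ a ∈ S ∧ b ∉ S) : numJoin σ τ = 1 := by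
  obtain ⟨a, ha⟩ := hr
  have key : ∀ x, (orbitSetoid σ ⊔ orbitSetoid τ) x a := by
    intro x
    obtain ⟨c, -, hc, -, hcS, -⟩ := h x
    exact Setoid.trans' _
      ((le_sup_left : orbitSetoid σ ≤ orbitSetoid σ ⊔ orbitSetoid τ) (show σ.SameCycle x c from hc))
      ((le_sup_right : orbitSetoid τ ≤ orbitSetoid σ ⊔ orbitSetoid τ)
        (show τ.SameCycle c a from hS.2 hcS ha))
  rw [numJoin, Nat.card_eq_one_iff_unique]
  refine ⟨⟨fun c d => ?_⟩, ⟨Quotient.mk _ a⟩⟩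
  induction c using Quotient.inductionOn with | _ x =>
  induction d using Quotient.inductionOn with | _ y =>
  exact Quotient.sound (Setoid.trans' _ (key x) (Setoid.symm' _ (key y)))

theorem isNoncrossingOn_and_iff_isBridging [Fintype α] [DecidableEq α]
    (hS : τ.IsCycleOn (S : Set α)) (hS' : τ.IsCycleOn ((Sᶜ : Finset α) : Set α))
    (hr : S.Nonempty) (hs : Sᶜ.Nonempty) :
    (IsNoncrossingOn σ τ ∧
      ∀ z, ∃ a b, σ.SameCycle z a ∧ σ.SameCycle z b ∧ a ∈ S ∧ b ∉ S) ↔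
      IsBridging (· ∈ S) τ σ := by
  have key : ∀ h : (∀ z, ∃ a b, σ.SameCycle z a ∧ σ.SameCycle z b ∧ a ∈ S ∧ b ∉ S),
      IsNoncrossingOn σ τ ↔ IsBridging (· ∈ S) τ σ := by
    intro h
    rw [← numOrbits_add_numOrbits_eq_iff (S := (· ∈ S)) (fun _ => hS.apply_mem_iff) h,
      IsNoncrossingOn, euler,
      numJoin_eq_one hS hr h, numOrbits_eq_two hS hS' hr hs, Nat.card_eq_fintype_card]
    omega
  exact ⟨fun h => (key h.2).1 h.1, fun h => ⟨(key h.meets).2 h, h.meets⟩⟩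

theorem finRotate_isCycleOn_univ (n : ℕ) : (finRotate n).IsCycleOn Set.univ := by
  refine ⟨by simpa using (finRotate n).bijective, fun x _ y _ => ?_⟩
  cases n with
  | zero => exact x.elim0
  | succ n =>
    have key : ∀ z : Fin (n + 1), (finRotate (n + 1)).SameCycle 0 z := by
      intro z
      induction z using Fin.induction with
      | zero => exact .refl _ _
      | succ i ih =>
        have : finRotate (n + 1) i.castSucc = i.succ := by simp
        exact this ▸ ih.apply_right
    exact (key x).symm.trans (key y)

theorem tauPQ_castAdd (r s : ℕ) (x : Fin r) :
    tauPQ r s (Fin.castAdd s x) = Fin.castAdd s (finRotate r x) := by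
  simp [tauPQ, Equiv.permCongr_apply]

theorem tauPQ_natAdd (r s : ℕ) (x : Fin s) :
    tauPQ r s (Fin.natAdd r x) = Fin.natAdd r (finRotate s x) := by
  simp [tauPQ, Equiv.permCongr_apply]

theorem isCycleOn_range {β : Type*} {ρ : Equiv.Perm β} {f : β → α}
    (h : ∀ x, τ (f x) = f (ρ x)) (hρ : ρ.IsCycleOn Set.univ) : τ.IsCycleOn (Set.range f) := by
  refine ⟨⟨?_, τ.injective.injOn, ?_⟩, ?_⟩
  · rintro _ ⟨x, rfl⟩
    exact ⟨ρ x, (h x).symm⟩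
  · rintro _ ⟨x, rfl⟩
    exact ⟨f (ρ⁻¹ x), ⟨_, rfl⟩, by rw [h]; simp⟩
  · rintro _ ⟨x, rfl⟩ _ ⟨y, rfl⟩
    obtain ⟨n, hn⟩ := hρ.2 (Set.mem_univ x) (Set.mem_univ y)
    refine ⟨n, ?_⟩
    rw [← hn]
    have hinv : ∀ x, τ⁻¹ (f x) = f (ρ⁻¹ x) := fun x => by
      rw [Equiv.Perm.inv_eq_iff_eq, h]
      simp
    induction n generalizing y with
    | zero => simp
    | succ n ih =>
      rw [add_comm, zpow_add, zpow_add, Equiv.Perm.mul_apply, Equiv.Perm.mul_apply, zpow_one,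
        zpow_one, ih _ rfl, h]
    | pred n ih =>
      rw [sub_eq_add_neg, add_comm, zpow_add, zpow_add, Equiv.Perm.mul_apply, Equiv.Perm.mul_apply,
        zpow_neg_one, zpow_neg_one, ih _ rfl, hinv]

/-- The first circle of the annulus. -/
def outerCircle (r s : ℕ) : Finset (Fin (r + s)) := Finset.univ.filter fun z => (z : ℕ) < r

theorem mem_outerCircle {r s : ℕ} {z : Fin (r + s)} : z ∈ outerCircle r s ↔ (z : ℕ) < r := by
  simp [outerCircle]

theorem coe_outerCircle (r s : ℕ) :
    (outerCircle r s : Set (Fin (r + s))) = Set.range (Fin.castAdd s) := by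
  ext z
  rw [Finset.mem_coe, mem_outerCircle]
  refine ⟨fun h => ⟨⟨z, h⟩, rfl⟩, ?_⟩
  rintro ⟨x, rfl⟩
  exact x.2

theorem coe_compl_outerCircle (r s : ℕ) :
    (((outerCircle r s)ᶜ : Finset (Fin (r + s))) : Set (Fin (r + s))) =
      Set.range (Fin.natAdd r) := by
  ext z
  rw [Finset.mem_coe, Finset.mem_compl, mem_outerCircle]
  refine ⟨fun h => ⟨⟨z - r, by omega⟩, Fin.ext (by simp; omega)⟩, ?_⟩
  rintro ⟨x, rfl⟩
  simp

theorem card_outerCircle (r s : ℕ) : (outerCircle r s).card = r := by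
  rw [← Set.ncard_coe_finset, coe_outerCircle, ← Set.image_univ,
    Set.ncard_image_of_injective _ (Fin.castAdd_injective r s), Set.ncard_univ, Nat.card_fin]

end Annulus

theorem mul_centralBinom_eq {r : ℕ} (hr : 1 ≤ r) :
    (r : ℚ) * r.centralBinom =
      2 * ((Nat.factorial (2 * r - 1) : ℚ) / (Nat.factorial (r - 1) : ℚ) ^ 2) := by
  obtain ⟨n, rfl⟩ := Nat.exists_eq_add_of_le' hr
  rw [Nat.centralBinom_eq_two_mul_choose, Nat.cast_choose ℚ (by omega),
    show 2 * (n + 1) - (n + 1) = n + 1 by omega, show 2 * (n + 1) - 1 = 2 * n + 1 by omega,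
    show 2 * (n + 1) = 2 * n + 1 + 1 by omega, Nat.factorial_succ (2 * n + 1), Nat.factorial_succ n,
    Nat.add_sub_cancel]
  have := Nat.factorial_ne_zero n
  push_cast
  field_simp
  ring

end AnnNC

open AnnNC in
/-- for `r, s ≥ 1`, the sum over all `σ ∈ S_ann-nc(r,s)` all of whose cycles
are bridges of `∏_{U ∈ Π(σ)} (−1)^{|U|−1} C_{|U|−1}` equals
`(−1)^{r+s−1} (2/(r+s)) ((2r−1)!/((r−1)!)²)((2s−1)!/((s−1)!)²)`. -/
theorem stmt16 (r s : ℕ) (hr : 1 ≤ r) (hs : 1 ≤ s) :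
    (∑ᶠ σ ∈ {σ : Equiv.Perm (Fin (r + s)) | σ ∈ SAnnNC r s ∧
        ∀ x : Fin (r + s), x ∈ BridgeSet r s σ}, (catProd σ : ℚ)) =
      (-1 : ℚ) ^ (r + s - 1) * (2 / ((r : ℚ) + (s : ℚ))) *
        ((Nat.factorial (2 * r - 1) : ℚ) / ((Nat.factorial (r - 1) : ℚ)) ^ 2) *
        ((Nat.factorial (2 * s - 1) : ℚ) / ((Nat.factorial (s - 1) : ℚ)) ^ 2) := by
  classical
  set S := outerCircle r s with hSdef
  have hS : (tauPQ r s).IsCycleOn (S : Set (Fin (r + s))) := by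
    rw [hSdef, coe_outerCircle]
    exact isCycleOn_range (tauPQ_castAdd r s)
      (finRotate_isCycleOn_univ r)
  have hS' : (tauPQ r s).IsCycleOn ((Sᶜ : Finset (Fin (r + s))) : Set (Fin (r + s))) := by
    rw [hSdef, coe_compl_outerCircle]
    exact isCycleOn_range (tauPQ_natAdd r s)
      (finRotate_isCycleOn_univ s)
  have hcard : S.card = r := card_outerCircle r s
  have hcard' : Sᶜ.card = s := by
    rw [Finset.card_compl, hcard, Fintype.card_fin, Nat.add_sub_cancel_left]
  have hset : {σ : Equiv.Perm (Fin (r + s)) | σ ∈ SAnnNC r s ∧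
      ∀ x : Fin (r + s), x ∈ BridgeSet r s σ} =
      ↑(Finset.univ.filter fun σ => IsBridging (· ∈ S) (tauPQ r s) σ) := by
    ext σ
    rw [Finset.coe_filter, Set.mem_ofPred_eq, Set.mem_ofPred_eq,
      ← isNoncrossingOn_and_iff_isBridging hS hS' (Finset.card_pos.1 (by omega))
        (Finset.card_pos.1 (by omega))]
    have hB : (∀ x, x ∈ BridgeSet r s σ) ↔
        ∀ z, ∃ a b, σ.SameCycle z a ∧ σ.SameCycle z b ∧ a ∈ S ∧ b ∉ S := by
      simp only [BridgeSet, Set.mem_ofPred_eq, hSdef, mem_outerCircle, not_lt]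
    rw [hB]
    simp only [Finset.mem_univ, true_and]
    refine and_congr_left fun h => ⟨And.left, fun h1 => ⟨h1, ?_⟩⟩
    obtain ⟨a, b, ha, hb, ha', hb'⟩ := h ⟨0, by omega⟩
    refine ⟨a, b, ha.symm.trans hb, mem_outerCircle.1 ha', ?_⟩
    rwa [hSdef, mem_outerCircle, not_lt] at hb'
  rw [hset, finsum_mem_coe_finset, Finset.sum_congr rfl fun σ _ => catProd_eq_cycleWeight σ]
  have h := card_mul_sum_isBridging hS hS'
  rw [hcard, hcard', Fintype.card_fin, Nat.cast_add] at h
  have hpos : (0 : ℚ) < (r : ℚ) + s := by positivity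
  rw [← mul_right_inj' hpos.ne', h]
  have hr' := mul_centralBinom_eq hr
  have hs' := mul_centralBinom_eq hs
  calc _ = (-1 : ℚ) ^ (r + s - 1) / 2 * (r * r.centralBinom) * (s * s.centralBinom) := by ring
    _ = _ := by
      rw [hr', hs']
      field_simp
end

section
/- Define, for real x, y with |x| < 1/4, |y| < 1/4 and x ≠ y, f(x,y) := xy·(1 + 2x + 2y − √(1+4x)·√(1+4y)) / (2·√(1+4x)·√(1+4y)·(x−y)²). Then for all such x, y, the derivative of z ↦ f(xz, yz) at z = 1 equals 2 · x·(1+4x)^{−3/2} · y·(1+4y)^{−3/2}. -/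
/-- Rationalised form of the kernel in terms of the square roots. -/
theorem kernel_eq_of_sqrt {a b : ℝ} (ha : 0 < 1 + 4 * a) (hb : 0 < 1 + 4 * b) (hab : a ≠ b) :
    a * b * (1 + 2 * a + 2 * b - √(1 + 4 * a) * √(1 + 4 * b)) /
        (2 * √(1 + 4 * a) * √(1 + 4 * b) * (a - b) ^ 2) =
      4 * (a * b) / (√(1 + 4 * a) * √(1 + 4 * b) * (√(1 + 4 * a) + √(1 + 4 * b)) ^ 2) := by
  have hA := Real.sqrt_pos.2 ha
  have hB := Real.sqrt_pos.2 hb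
  have hA2 := Real.sq_sqrt ha.le
  have hB2 := Real.sq_sqrt hb.le
  generalize √(1 + 4 * a) = A at *
  generalize √(1 + 4 * b) = B at *
  have hd : (a - b) ^ 2 = (A - B) ^ 2 * (A + B) ^ 2 / 16 := by
    rw [show a - b = (A - B) * (A + B) / 4 by linarith]
    ring
  have hnum : 1 + 2 * a + 2 * b - A * B = (A - B) ^ 2 / 2 := by linarith
  have hAB : A - B ≠ 0 := by
    intro h
    have h' : A = B := sub_eq_zero.1 h
    subst h'
    exact hab (by linarith)
  rw [hd, hnum]
  field_simp
  ring

theorem rpow_neg_three_halves {t : ℝ} (ht : 0 < t) : t ^ (-(3 : ℝ) / 2) = (√t ^ 3)⁻¹ := by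
  rw [Real.sqrt_eq_rpow, ← Real.rpow_natCast, ← Real.rpow_mul ht.le, ← Real.rpow_neg ht.le]
  norm_num

theorem hasDerivAt_sqrt_one_add_four_mul {x : ℝ} (hx : 0 < 1 + 4 * x) :
    HasDerivAt (fun z : ℝ => √(1 + 4 * (x * z))) (2 * x / √(1 + 4 * x)) 1 := by
  have h : HasDerivAt (fun z : ℝ => 1 + 4 * (x * z)) (4 * x) 1 := by
    simpa using (((hasDerivAt_id (1 : ℝ)).const_mul x).const_mul 4).const_add 1
  refine (h.sqrt (by simpa using hx.ne')).congr_deriv ?_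
  rw [mul_one]
  ring

/-- with
`f(a,b) = ab(1+2a+2b−√(1+4a)√(1+4b)) / (2√(1+4a)√(1+4b)(a−b)²)`,
for `|x| < 1/4`, `|y| < 1/4`, `x ≠ y`, the derivative of `z ↦ f(xz, yz)` at `z = 1`
equals `2 · x(1+4x)^{−3/2} · y(1+4y)^{−3/2}`. -/
theorem stmt17 (x y : ℝ) (hx : |x| < 1 / 4) (hy : |y| < 1 / 4) (hxy : x ≠ y) :
    HasDerivAt (fun z : ℝ =>
        (x * z) * (y * z) *
          (1 + 2 * (x * z) + 2 * (y * z) -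
            Real.sqrt (1 + 4 * (x * z)) * Real.sqrt (1 + 4 * (y * z))) /
          (2 * Real.sqrt (1 + 4 * (x * z)) * Real.sqrt (1 + 4 * (y * z)) *
            (x * z - y * z) ^ 2))
      (2 * (x * (1 + 4 * x) ^ (-(3 : ℝ) / 2)) * (y * (1 + 4 * y) ^ (-(3 : ℝ) / 2))) 1 := by
  have hx' : 0 < 1 + 4 * x := by linarith [(abs_lt.1 hx).1]
  have hy' : 0 < 1 + 4 * y := by linarith [(abs_lt.1 hy).1]
  have hpos : ∀ {t : ℝ}, 0 < 1 + 4 * t → ∀ᶠ z in nhds (1 : ℝ), 0 < 1 + 4 * (t * z) := by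
    intro t ht
    have hc : Continuous fun z : ℝ => 1 + 4 * (t * z) := by fun_prop
    exact hc.continuousAt.eventually (lt_mem_nhds (by simpa using ht))
  have hA := Real.sqrt_pos.2 hx'
  have hB := Real.sqrt_pos.2 hy'
  have hmul : HasDerivAt (fun z : ℝ => 4 * (x * z * (y * z))) (8 * (x * y)) 1 := by
    have hlin (t : ℝ) : HasDerivAt (fun z : ℝ => t * z) t 1 := by
      simpa using (hasDerivAt_id (1 : ℝ)).const_mul t
    exact (((hlin x).fun_mul (hlin y)).const_mul 4).congr_deriv (by ring)
  have hdx := hasDerivAt_sqrt_one_add_four_mul hx'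
  have hdy := hasDerivAt_sqrt_one_add_four_mul hy'
  have key := hmul.fun_div ((hdx.fun_mul hdy).fun_mul ((hdx.fun_add hdy).fun_pow 2))
    (by simp only [mul_one]; positivity)
  refine HasDerivAt.congr_of_eventuallyEq (f := fun z : ℝ => 4 * (x * z * (y * z)) /
    (√(1 + 4 * (x * z)) * √(1 + 4 * (y * z)) *
      (√(1 + 4 * (x * z)) + √(1 + 4 * (y * z))) ^ 2)) ?_ ?_
  · refine key.congr_deriv ?_
    rw [rpow_neg_three_halves hx', rpow_neg_three_halves hy']
    have hA2 := Real.sq_sqrt hx'.le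
    have hB2 := Real.sq_sqrt hy'.le
    simp only [mul_one, Nat.cast_ofNat, Nat.add_one_sub_one, pow_one]
    generalize √(1 + 4 * x) = A at *
    generalize √(1 + 4 * y) = B at *
    obtain rfl : x = (A ^ 2 - 1) / 4 := by linarith
    obtain rfl : y = (B ^ 2 - 1) / 4 := by linarith
    field_simp
    ring
  · filter_upwards [hpos hx', hpos hy', eventually_ne_nhds one_ne_zero] with z hxz hyz hz
    exact kernel_eq_of_sqrt hxz hyz fun h => hxy (mul_right_cancel₀ hz h)
end
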